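/- arXiv:2205.03387 — 5 statements merged into one kernel-verified Lean document; each statement's English description precedes it below -/
import Mathlib

section
/- (Corollary on semisimplicity of D.6_a.) For a ∈ ℂ, the Lie algebra 𝔣_a is semisimple if and only if a² ∉ {−9/4, 4}, and in that case 𝔣_a is isomorphic to sl(2,ℂ) × sl(2,ℂ). -/
set_option maxHeartbeats 1000000

section AbelianIdeal

variable {L : Type*} [LieRing L] [LieAlgebra ℂ L]

theorem LieIdeal.lie_eq_zero_of_isLieAbelian (I : LieIdeal ℂ L) [IsLieAbelian I] {x y : L}
    (hx : x ∈ I) (hy : y ∈ I) : ⁅x, y⁆ = 0 :=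
  congrArg Subtype.val (trivial_lie_zero I I ⟨x, hx⟩ ⟨y, hy⟩)

theorem IsSl2Triple.e_notMem_of_isLieAbelian {h e f : L} (t : IsSl2Triple h e f)
    (I : LieIdeal ℂ L) [IsLieAbelian I] : e ∉ I := by
  intro he
  have hh : h ∈ I := t.lie_e_f ▸ lie_mem_left ℂ L I e f he
  have h0 := I.lie_eq_zero_of_isLieAbelian hh he
  rw [t.lie_h_e_smul ℂ] at h0
  exact t.e_ne_zero ((smul_eq_zero.mp h0).resolve_left two_ne_zero)

theorem IsSl2Triple.coeff_eq_zero_of_mem {h e f y : L} (t : IsSl2Triple h e f)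
    (I : LieIdeal ℂ L) [IsLieAbelian I] (hey : ⁅e, y⁆ = 0) (hfy : ⁅f, y⁆ = 0) {α β γ : ℂ}
    (hx : α • h + β • e + γ • f + y ∈ I) : α = 0 ∧ β = 0 ∧ γ = 0 := by
  have heI := t.e_notMem_of_isLieAbelian I
  have hfI := t.symm.e_notMem_of_isLieAbelian I
  have heh : ⁅e, h⁆ = -((2 : ℂ) • e) := by rw [← lie_skew, t.lie_h_e_smul ℂ]
  have hfh : ⁅f, h⁆ = (2 : ℂ) • f := by rw [← lie_skew, t.lie_lie_smul_f ℂ, neg_neg]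
  have hfe : ⁅f, e⁆ = -h := by rw [← lie_skew, t.lie_e_f]
  have hex : ⁅e, α • h + β • e + γ • f + y⁆ = (-2 * α) • e + γ • h := by
    simp only [lie_add, lie_smul, lie_self, heh, t.lie_e_f, hey]
    module
  have hfx : ⁅f, α • h + β • e + γ • f + y⁆ = (2 * α) • f - β • h := by
    simp only [lie_add, lie_smul, lie_self, hfh, hfe, hfy]
    module
  have hexI := lie_mem_right ℂ L I e _ hx
  have hγ : γ = 0 := by
    have h2 := lie_mem_right ℂ L I e _ hexI
    rw [hex, lie_add, lie_smul, lie_smul, lie_self, heh,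
      show (-2 * α) • (0 : L) + γ • -((2 : ℂ) • e) = (-2 * γ) • e by module] at h2
    by_contra hne
    exact heI ((Submodule.smul_mem_iff I.toSubmodule
      (mul_ne_zero (neg_ne_zero.mpr two_ne_zero) hne)).mp h2)
  have hβ : β = 0 := by
    have h2 := lie_mem_right ℂ L I f _ (lie_mem_right ℂ L I f _ hx)
    rw [hfx, lie_sub, lie_smul, lie_smul, lie_self, hfh,
      show (2 * α) • (0 : L) - β • ((2 : ℂ) • f) = (-2 * β) • f by module] at h2
    by_contra hne
    exact hfI ((Submodule.smul_mem_iff I.toSubmodule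
      (mul_ne_zero (neg_ne_zero.mpr two_ne_zero) hne)).mp h2)
  refine ⟨?_, hβ, hγ⟩
  rw [hex, hγ, zero_smul, add_zero] at hexI
  by_contra hne
  exact heI ((Submodule.smul_mem_iff I.toSubmodule
    (mul_ne_zero (neg_ne_zero.mpr two_ne_zero) hne)).mp hexI)

/-- A Lie algebra is not semisimple if pairwise commuting vectors, not all zero, span a subspace
stable under bracketing with a spanning set. -/
theorem not_isSemisimple_of_commuting {ι κ : Type*} {b : ι → L} {v : κ → L}
    (hb : Submodule.span ℂ (Set.range b) = ⊤)
    (hbv : ∀ i j, ⁅b i, v j⁆ ∈ Submodule.span ℂ (Set.range v))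
    (hv : ∀ i j, ⁅v i, v j⁆ = 0) {k : κ} (hk : v k ≠ 0) :
    ¬ LieAlgebra.IsSemisimple ℂ L := by
  intro _
  let I : LieIdeal ℂ L :=
    { Submodule.span ℂ (Set.range v) with
      lie_mem := by
        intro x m hm
        change ⁅x, m⁆ ∈ Submodule.span ℂ (Set.range v)
        have hx : x ∈ Submodule.span ℂ (Set.range b) := hb ▸ Submodule.mem_top
        induction hx, hm using Submodule.span_induction₂ with
        | mem_mem x y hx hy =>
          obtain ⟨i, rfl⟩ := hx
          obtain ⟨j, rfl⟩ := hy
          exact hbv i j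
        | zero_left => simp
        | zero_right => simp
        | add_left x y z _ _ _ h₁ h₂ => rw [add_lie]; exact add_mem h₁ h₂
        | add_right x y z _ _ _ h₁ h₂ => rw [lie_add]; exact add_mem h₁ h₂
        | smul_left r x y _ _ h => rw [smul_lie]; exact Submodule.smul_mem _ _ h
        | smul_right r x y _ _ h => rw [lie_smul]; exact Submodule.smul_mem _ _ h }
  have hI : IsLieAbelian I := by
    refine ⟨fun ⟨x, hx⟩ ⟨y, hy⟩ ↦ Subtype.ext ?_⟩
    change x ∈ Submodule.span ℂ (Set.range v) at hx
    change y ∈ Submodule.span ℂ (Set.range v) at hy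
    change ⁅x, y⁆ = 0
    induction hx, hy using Submodule.span_induction₂ with
    | mem_mem x y hx hy =>
      obtain ⟨i, rfl⟩ := hx
      obtain ⟨j, rfl⟩ := hy
      exact hv i j
    | zero_left => simp
    | zero_right => simp
    | add_left x y z _ _ _ h₁ h₂ => rw [add_lie, h₁, h₂, add_zero]
    | add_right x y z _ _ _ h₁ h₂ => rw [lie_add, h₁, h₂, add_zero]
    | smul_left r x y _ _ h => rw [smul_lie, h, smul_zero]
    | smul_right r x y _ _ h => rw [lie_smul, h, smul_zero]
  have hbot := (LieAlgebra.hasTrivialRadical_iff_no_abelian_ideals ℂ L).mp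
    (inferInstance : LieAlgebra.HasTrivialRadical ℂ L) I hI
  have hmem : v k ∈ I := Submodule.subset_span (Set.mem_range_self k)
  rw [hbot] at hmem
  exact hk ((LieSubmodule.mem_bot _).mp hmem)

end AbelianIdeal

/-- Two Lie algebras with bases having the same structure constants are isomorphic; it suffices to
compare the brackets of basis vectors in increasing order. -/
theorem nonempty_lieEquiv_of_basis {ι L L' : Type*} [LinearOrder ι] [LieRing L] [LieAlgebra ℂ L]
    [LieRing L'] [LieAlgebra ℂ L'] (b : Module.Basis ι ℂ L) (b' : Module.Basis ι ℂ L')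
    (h : ∀ i j, i < j → b.equiv b' (Equiv.refl ι) ⁅b i, b j⁆ = ⁅b' i, b' j⁆) :
    Nonempty (L ≃ₗ⁅ℂ⁆ L') := by
  let φ := b.equiv b' (Equiv.refl ι)
  have hφ (i : ι) : φ (b i) = b' i := by simp [φ]
  have hbasis (i j : ι) : φ ⁅b i, b j⁆ = ⁅φ (b i), φ (b j)⁆ := by
    rw [hφ, hφ]
    rcases lt_trichotomy i j with hij | rfl | hij
    · exact h i j hij
    · simp
    · rw [← lie_skew, map_neg, ← lie_skew (b' i), neg_inj]
      exact h j i hij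
  have hlie (x y : L) : φ ⁅x, y⁆ = ⁅φ x, φ y⁆ := by
    have hx : x ∈ Submodule.span ℂ (Set.range b) := b.span_eq ▸ Submodule.mem_top
    have hy : y ∈ Submodule.span ℂ (Set.range b) := b.span_eq ▸ Submodule.mem_top
    induction hx, hy using Submodule.span_induction₂ with
    | mem_mem x y hx hy =>
      obtain ⟨i, rfl⟩ := hx
      obtain ⟨j, rfl⟩ := hy
      exact hbasis i j
    | zero_left => simp
    | zero_right => simp
    | add_left x y z _ _ _ h₁ h₂ => simp only [add_lie, map_add, h₁, h₂]
    | add_right x y z _ _ _ h₁ h₂ => simp only [lie_add, map_add, h₁, h₂]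
    | smul_left r x y _ _ h => simp only [smul_lie, map_smul, h]
    | smul_right r x y _ _ h => simp only [lie_smul, map_smul, h]
  exact ⟨{ φ with map_lie' := hlie _ _ }⟩

/-- Two `sl₂` triples which commute with each other and together span the Lie algebra `L`. -/
structure IsSl2ProdTable {L : Type*} [LieRing L] [LieAlgebra ℂ L] (h e f h' e' f' : L) : Prop where
  fst : IsSl2Triple h e f
  snd : IsSl2Triple h' e' f'
  hh : ⁅h, h'⁆ = 0
  he : ⁅h, e'⁆ = 0
  hf : ⁅h, f'⁆ = 0
  eh : ⁅e, h'⁆ = 0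
  ee : ⁅e, e'⁆ = 0
  ef : ⁅e, f'⁆ = 0
  fh : ⁅f, h'⁆ = 0
  fe : ⁅f, e'⁆ = 0
  ff : ⁅f, f'⁆ = 0
  span_eq_top : Submodule.span ℂ (Set.range ![h, e, f, h', e', f']) = ⊤

namespace IsSl2ProdTable

variable {L L' : Type*} [LieRing L] [LieAlgebra ℂ L] [LieRing L'] [LieAlgebra ℂ L']

theorem hasTrivialRadical {h e f h' e' f' : L} (t : IsSl2ProdTable h e f h' e' f') :
    LieAlgebra.HasTrivialRadical ℂ L := by
  refine (LieAlgebra.hasTrivialRadical_iff_no_abelian_ideals ℂ L).mpr fun I _ ↦ ?_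
  refine (LieSubmodule.eq_bot_iff I).mpr fun x hx ↦ ?_
  have hspan : x ∈ Submodule.span ℂ (Set.range ![h, e, f, h', e', f']) :=
    t.span_eq_top ▸ Submodule.mem_top
  obtain ⟨c, rfl⟩ := (Submodule.mem_span_range_iff_exists_fun ℂ).mp hspan
  simp only [Fin.sum_univ_six, Matrix.cons_val] at hx ⊢
  obtain ⟨h₀, h₁, h₂⟩ := t.fst.coeff_eq_zero_of_mem I (α := c 0) (β := c 1) (γ := c 2)
    (y := c 3 • h' + c 4 • e' + c 5 • f')
    (by simp [t.eh, t.ee, t.ef]) (by simp [t.fh, t.fe, t.ff]) (by convert hx using 1; module)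
  have he' : ⁅e', h⁆ = 0 := by rw [← lie_skew, t.he, neg_zero]
  have hf' : ⁅f', h⁆ = 0 := by rw [← lie_skew, t.hf, neg_zero]
  obtain ⟨h₃, h₄, h₅⟩ := t.snd.coeff_eq_zero_of_mem I (α := c 3) (β := c 4) (γ := c 5)
    (y := 0) (lie_zero _) (lie_zero _) (by convert hx using 1; rw [h₀, h₁, h₂]; module)
  simp [h₀, h₁, h₂, h₃, h₄, h₅]

theorem nonempty_lieEquiv {h e f h' e' f' : L} {k x y k' x' y' : L'}
    (t : IsSl2ProdTable h e f h' e' f') (u : IsSl2ProdTable k x y k' x' y')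
    (ht : LinearIndependent ℂ ![h, e, f, h', e', f'])
    (hu : LinearIndependent ℂ ![k, x, y, k', x', y']) : Nonempty (L ≃ₗ⁅ℂ⁆ L') := by
  let b : Module.Basis (Fin 6) ℂ L := Module.Basis.mk ht t.span_eq_top.ge
  let b' : Module.Basis (Fin 6) ℂ L' := Module.Basis.mk hu u.span_eq_top.ge
  refine nonempty_lieEquiv_of_basis b b' fun i j hij ↦ ?_
  set φ := b.equiv b' (Equiv.refl _)
  have hφ (i : Fin 6) : φ (![h, e, f, h', e', f'] i) = ![k, x, y, k', x', y'] i := by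
    simpa [b, b'] using b.equiv_apply i b' (Equiv.refl _)
  have h0 : φ h = k := hφ 0
  have h1 : φ e = x := hφ 1
  have h2 : φ f = y := hφ 2
  have h3 : φ h' = k' := hφ 3
  have h4 : φ e' = x' := hφ 4
  have h5 : φ f' = y' := hφ 5
  fin_cases i <;> fin_cases j <;> first | exact absurd hij (by decide) | skip
  all_goals
    simp [b, b', h0, h1, h2, h3, h4, h5, t.hh, t.he, t.hf, t.eh, t.ee, t.ef, t.fh, t.fe, t.ff,
      u.hh, u.he, u.hf, u.eh, u.ee, u.ef, u.fh, u.fe, u.ff, t.fst.lie_e_f, t.snd.lie_e_f,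
      u.fst.lie_e_f, u.snd.lie_e_f, t.fst.lie_h_e_smul ℂ, t.snd.lie_h_e_smul ℂ,
      u.fst.lie_h_e_smul ℂ, u.snd.lie_h_e_smul ℂ, t.fst.lie_lie_smul_f ℂ, t.snd.lie_lie_smul_f ℂ,
      u.fst.lie_lie_smul_f ℂ, u.snd.lie_lie_smul_f ℂ]

end IsSl2ProdTable

/-- The type D.6 bracket table with parameter `a`, on a spanning family of `L`. -/
structure IsD6Table {L : Type*} [LieRing L] [LieAlgebra ℂ L] (a : ℂ) (T X1 X2 X3 X4 X5 : L) :
    Prop where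
  lie_T_X1 : ⁅T, X1⁆ = X1
  lie_T_X2 : ⁅T, X2⁆ = -X2
  lie_T_X3 : ⁅T, X3⁆ = 0
  lie_T_X4 : ⁅T, X4⁆ = X4
  lie_T_X5 : ⁅T, X5⁆ = -X5
  lie_X1_X2 : ⁅X1, X2⁆ = (3*a) • T + (-2 : ℂ) • X3
  lie_X1_X3 : ⁅X1, X3⁆ = (2*a) • X1 + (3 : ℂ) • X4
  lie_X1_X4 : ⁅X1, X4⁆ = 0
  lie_X1_X5 : ⁅X1, X5⁆ = (6 : ℂ) • T + (-a) • X3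
  lie_X2_X3 : ⁅X2, X3⁆ = (-(2*a)) • X2 + (-3 : ℂ) • X5
  lie_X2_X4 : ⁅X2, X4⁆ = (-6 : ℂ) • T + a • X3
  lie_X2_X5 : ⁅X2, X5⁆ = 0
  lie_X3_X4 : ⁅X3, X4⁆ = (-(a^2+3)) • X1
  lie_X3_X5 : ⁅X3, X5⁆ = (a^2+3) • X2
  lie_X4_X5 : ⁅X4, X5⁆ = (a*(a^2-1)) • T + (-2 : ℂ) • X3
  span_eq_top : Submodule.span ℂ (Set.range ![T, X1, X2, X3, X4, X5]) = ⊤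

namespace IsD6Table

variable {L : Type*} [LieRing L] [LieAlgebra ℂ L] {a : ℂ} {T X1 X2 X3 X4 X5 : L}
theorem lie_X1_T (t : IsD6Table a T X1 X2 X3 X4 X5) :
    ⁅X1, T⁆ = -(X1) := by
  rw [← lie_skew, t.lie_T_X1]

theorem lie_X2_T (t : IsD6Table a T X1 X2 X3 X4 X5) :
    ⁅X2, T⁆ = -(-X2) := by
  rw [← lie_skew, t.lie_T_X2]

theorem lie_X3_T (t : IsD6Table a T X1 X2 X3 X4 X5) :
    ⁅X3, T⁆ = 0 := by
  rw [← lie_skew, t.lie_T_X3, neg_zero]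

theorem lie_X4_T (t : IsD6Table a T X1 X2 X3 X4 X5) :
    ⁅X4, T⁆ = -(X4) := by
  rw [← lie_skew, t.lie_T_X4]

theorem lie_X5_T (t : IsD6Table a T X1 X2 X3 X4 X5) :
    ⁅X5, T⁆ = -(-X5) := by
  rw [← lie_skew, t.lie_T_X5]

theorem lie_X2_X1 (t : IsD6Table a T X1 X2 X3 X4 X5) :
    ⁅X2, X1⁆ = -((3*a) • T + (-2 : ℂ) • X3) := by
  rw [← lie_skew, t.lie_X1_X2]

theorem lie_X3_X1 (t : IsD6Table a T X1 X2 X3 X4 X5) :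
    ⁅X3, X1⁆ = -((2*a) • X1 + (3 : ℂ) • X4) := by
  rw [← lie_skew, t.lie_X1_X3]

theorem lie_X4_X1 (t : IsD6Table a T X1 X2 X3 X4 X5) :
    ⁅X4, X1⁆ = 0 := by
  rw [← lie_skew, t.lie_X1_X4, neg_zero]

theorem lie_X5_X1 (t : IsD6Table a T X1 X2 X3 X4 X5) :
    ⁅X5, X1⁆ = -((6 : ℂ) • T + (-a) • X3) := by
  rw [← lie_skew, t.lie_X1_X5]

theorem lie_X3_X2 (t : IsD6Table a T X1 X2 X3 X4 X5) :
    ⁅X3, X2⁆ = -((-(2*a)) • X2 + (-3 : ℂ) • X5) := by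
  rw [← lie_skew, t.lie_X2_X3]

theorem lie_X4_X2 (t : IsD6Table a T X1 X2 X3 X4 X5) :
    ⁅X4, X2⁆ = -((-6 : ℂ) • T + a • X3) := by
  rw [← lie_skew, t.lie_X2_X4]

theorem lie_X5_X2 (t : IsD6Table a T X1 X2 X3 X4 X5) :
    ⁅X5, X2⁆ = 0 := by
  rw [← lie_skew, t.lie_X2_X5, neg_zero]

theorem lie_X4_X3 (t : IsD6Table a T X1 X2 X3 X4 X5) :
    ⁅X4, X3⁆ = -((-(a^2+3)) • X1) := by
  rw [← lie_skew, t.lie_X3_X4]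

theorem lie_X5_X3 (t : IsD6Table a T X1 X2 X3 X4 X5) :
    ⁅X5, X3⁆ = -((a^2+3) • X2) := by
  rw [← lie_skew, t.lie_X3_X5]

theorem lie_X5_X4 (t : IsD6Table a T X1 X2 X3 X4 X5) :
    ⁅X5, X4⁆ = -((a*(a^2-1)) • T + (-2 : ℂ) • X3) := by
  rw [← lie_skew, t.lie_X4_X5]

/-- `-l X₁ + 3 X₄` is an eigenvector of `ad X₃` when `l` is a root of `l² + 2al - 3(a² + 3)`. -/
theorem lie_sub_root_e (t : IsD6Table a T X1 X2 X3 X4 X5) {l m : ℂ}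
    (hl : l ^ 2 + 2 * a * l = 3 * (a ^ 2 + 3)) :
    ⁅X3 - m • T, -l • X1 + (3 : ℂ) • X4⁆ = (l - m) • (-l • X1 + (3 : ℂ) • X4) := by
  simp only [lie_add, sub_lie, lie_smul, smul_lie, t.lie_T_X1, t.lie_T_X4, t.lie_X3_X1,
    t.lie_X3_X4]
  match_scalars <;> grind

theorem lie_sub_root_f (t : IsD6Table a T X1 X2 X3 X4 X5) {l m : ℂ}
    (hl : l ^ 2 + 2 * a * l = 3 * (a ^ 2 + 3)) :
    ⁅X3 - m • T, -l • X2 + (3 : ℂ) • X5⁆ = (m - l) • (-l • X2 + (3 : ℂ) • X5) := by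
  simp only [lie_add, sub_lie, lie_smul, smul_lie, t.lie_T_X2, t.lie_T_X5, t.lie_X3_X2,
    t.lie_X3_X5]
  match_scalars <;> grind

theorem lie_root_e_f (t : IsD6Table a T X1 X2 X3 X4 X5) {l m : ℂ}
    (hs : l + m = -2 * a) (hp : l * m = -3 * (a ^ 2 + 3)) :
    ⁅-l • X1 + (3 : ℂ) • X4, -l • X2 + (3 : ℂ) • X5⁆ =
      (10 * a * l - 6 * a ^ 2 - 36) • (X3 - m • T) := by
  simp only [lie_add, add_lie, lie_smul, smul_lie, t.lie_X1_X2, t.lie_X1_X5, t.lie_X4_X2,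
    t.lie_X4_X5]
  match_scalars <;> grind

theorem lie_root_e_f_of_ne (t : IsD6Table a T X1 X2 X3 X4 X5) {l m : ℂ} (hs : l + m = -2 * a)
    (hp : l * m = -3 * (a ^ 2 + 3)) :
    ⁅-l • X1 + (3 : ℂ) • X4, -m • X2 + (3 : ℂ) • X5⁆ = 0 := by
  simp only [lie_add, add_lie, lie_smul, smul_lie, t.lie_X1_X2, t.lie_X1_X5, t.lie_X4_X2,
    t.lie_X4_X5]
  match_scalars <;> grind

theorem lie_root_e_e (t : IsD6Table a T X1 X2 X3 X4 X5) (l m : ℂ) :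
    ⁅-l • X1 + (3 : ℂ) • X4, -m • X1 + (3 : ℂ) • X4⁆ = 0 := by
  simp [t.lie_X1_X4, t.lie_X4_X1]

theorem lie_root_f_f (t : IsD6Table a T X1 X2 X3 X4 X5) (l m : ℂ) :
    ⁅-l • X2 + (3 : ℂ) • X5, -m • X2 + (3 : ℂ) • X5⁆ = 0 := by
  simp [t.lie_X2_X5, t.lie_X5_X2]

/-- The `sl₂` triple attached to the root `l`, where `m` is the other root. -/
theorem isSl2Triple_root (t : IsD6Table a T X1 X2 X3 X4 X5) {l m : ℂ}
    (hs : l + m = -2 * a) (hp : l * m = -3 * (a ^ 2 + 3)) (hlm : l - m ≠ 0)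
    (hc : 10 * a * l - 6 * a ^ 2 - 36 ≠ 0) (h0 : X3 - m • T ≠ 0) :
    IsSl2Triple ((2 / (l - m)) • (X3 - m • T)) (-l • X1 + (3 : ℂ) • X4)
      ((2 / ((10 * a * l - 6 * a ^ 2 - 36) * (l - m))) • (-l • X2 + (3 : ℂ) • X5)) where
  h_ne_zero := smul_ne_zero (div_ne_zero two_ne_zero hlm) h0
  lie_e_f := by
    rw [lie_smul, t.lie_root_e_f hs hp, smul_smul]
    congr 1
    generalize 10 * a * l - 6 * a ^ 2 - 36 = c at hc ⊢
    field_simp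
  lie_h_e_nsmul := by
    rw [smul_lie, t.lie_sub_root_e (by grind), smul_smul, div_mul_cancel₀ _ hlm,
      ofNat_smul_eq_nsmul]
  lie_h_f_nsmul := by
    rw [smul_lie, lie_smul, t.lie_sub_root_f (by grind), ← Nat.cast_smul_eq_nsmul ℂ]
    match_scalars <;> field_simp <;> ring

theorem root_vectors_span_eq_top (t : IsD6Table a T X1 X2 X3 X4 X5) {l m p q r s : ℂ}
    (hlm : l - m ≠ 0) (hp : p ≠ 0) (hq : q ≠ 0) (hr : r ≠ 0) (hs : s ≠ 0) :
    Submodule.span ℂ (Set.range ![p • (X3 - m • T), -l • X1 + (3 : ℂ) • X4,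
      q • (-l • X2 + (3 : ℂ) • X5), r • (X3 - l • T), -m • X1 + (3 : ℂ) • X4,
      s • (-m • X2 + (3 : ℂ) • X5)]) = ⊤ := by
  refine top_le_iff.mp (t.span_eq_top.ge.trans (Submodule.span_le.mpr ?_))
  rintro _ ⟨i, rfl⟩
  refine (Submodule.mem_span_range_iff_exists_fun ℂ).mpr ?_
  fin_cases i
  · refine ⟨![1 / (p * (l - m)), 0, 0, -1 / (r * (l - m)), 0, 0], ?_⟩
    change _ = T
    simp only [Fin.sum_univ_six, Matrix.cons_val]
    match_scalars <;> field_simp <;> ring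
  · refine ⟨![0, -1 / (l - m), 0, 0, 1 / (l - m), 0], ?_⟩
    change _ = X1
    simp only [Fin.sum_univ_six, Matrix.cons_val]
    match_scalars <;> field_simp <;> ring
  · refine ⟨![0, 0, -1 / (q * (l - m)), 0, 0, 1 / (s * (l - m))], ?_⟩
    change _ = X2
    simp only [Fin.sum_univ_six, Matrix.cons_val]
    match_scalars <;> field_simp <;> ring
  · refine ⟨![l / (p * (l - m)), 0, 0, -m / (r * (l - m)), 0, 0], ?_⟩
    change _ = X3
    simp only [Fin.sum_univ_six, Matrix.cons_val]
    match_scalars <;> field_simp <;> ring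
  · refine ⟨![0, -m / (3 * (l - m)), 0, 0, l / (3 * (l - m)), 0], ?_⟩
    change _ = X4
    simp only [Fin.sum_univ_six, Matrix.cons_val]
    match_scalars <;> field_simp <;> ring
  · refine ⟨![0, 0, -m / (3 * q * (l - m)), 0, 0, l / (3 * s * (l - m))], ?_⟩
    change _ = X5
    simp only [Fin.sum_univ_six, Matrix.cons_val]
    match_scalars <;> field_simp <;> ring

theorem exists_isSl2ProdTable (t : IsD6Table a T X1 X2 X3 X4 X5)
    (hind : LinearIndependent ℂ ![T, X1, X2, X3, X4, X5]) (ha : a ^ 2 ≠ -9 / 4)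
    (ha' : a ^ 2 ≠ 4) : ∃ h e f h' e' f' : L, IsSl2ProdTable h e f h' e' f' := by
  obtain ⟨d, hd⟩ := IsAlgClosed.exists_pow_nat_eq (4 * a ^ 2 + 9) two_pos
  obtain ⟨l, hl⟩ : ∃ l, l = -a + d := ⟨_, rfl⟩
  obtain ⟨m, hm⟩ : ∃ m, m = -a - d := ⟨_, rfl⟩
  have hs : l + m = -2 * a := by grind
  have hp : l * m = -3 * (a ^ 2 + 3) := by grind
  have hs' : m + l = -2 * a := by grind
  have hp' : m * l = -3 * (a ^ 2 + 3) := by grind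
  have hlm : l - m ≠ 0 := by
    intro h
    exact ha (by grind)
  have hml : m - l ≠ 0 := by grind
  have hcc : (10 * a * l - 6 * a ^ 2 - 36) * (10 * a * m - 6 * a ^ 2 - 36) ≠ 0 := by
    have : (10 * a * l - 6 * a ^ 2 - 36) * (10 * a * m - 6 * a ^ 2 - 36) =
        -36 * ((a ^ 2 - 4) * (4 * a ^ 2 + 9)) := by
      linear_combination 100 * a ^ 2 * hp - 10 * a * (6 * a ^ 2 + 36) * hs
    rw [this]
    refine mul_ne_zero (by norm_num) (mul_ne_zero (sub_ne_zero.mpr ha') ?_)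
    intro h
    exact ha (by linear_combination h / 4)
  have hc := left_ne_zero_of_mul hcc
  have hc' := right_ne_zero_of_mul hcc
  have h0 (z : ℂ) : X3 - z • T ≠ 0 := by
    intro h
    have := Fintype.linearIndependent_iff.mp hind ![-z, 0, 0, 1, 0, 0]
      (by simp only [Fin.sum_univ_six, Matrix.cons_val]; rw [← h]; module) 3
    simp at this
  refine ⟨_, _, _, _, _, _, t.isSl2Triple_root hs hp hlm hc (h0 m),
    t.isSl2Triple_root hs' hp' hml hc' (h0 l), ?_, ?_, ?_, ?_, ?_, ?_, ?_, ?_, ?_,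
    t.root_vectors_span_eq_top hlm (div_ne_zero two_ne_zero hlm)
      (div_ne_zero two_ne_zero (mul_ne_zero hc hlm)) (div_ne_zero two_ne_zero hml)
      (div_ne_zero two_ne_zero (mul_ne_zero hc' hml))⟩
  · simp [t.lie_T_X3, t.lie_X3_T]
  · rw [smul_lie, t.lie_sub_root_e (by grind), sub_self, zero_smul, smul_zero]
  · rw [smul_lie, lie_smul, t.lie_sub_root_f (by grind), sub_self, zero_smul, smul_zero, smul_zero]
  · rw [lie_smul, ← lie_skew, t.lie_sub_root_e (by grind), sub_self, zero_smul, neg_zero, smul_zero]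
  · exact t.lie_root_e_e l m
  · rw [lie_smul, t.lie_root_e_f_of_ne hs hp, smul_zero]
  · rw [smul_lie, lie_smul, ← lie_skew, t.lie_sub_root_f (by grind), sub_self, zero_smul, neg_zero,
      smul_zero, smul_zero]
  · rw [smul_lie, ← lie_skew, t.lie_root_e_f_of_ne hs' hp', neg_zero, smul_zero]
  · rw [smul_lie, lie_smul, t.lie_root_f_f l m, smul_zero, smul_zero]

theorem not_isSemisimple_of_sq_eq_four (t : IsD6Table a T X1 X2 X3 X4 X5)
    (hind : LinearIndependent ℂ ![T, X1, X2, X3, X4, X5]) (ha : a ^ 2 = 4) :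
    ¬ LieAlgebra.IsSemisimple ℂ L := by
  have h0 : (-a / 2) • X1 + X4 ≠ 0 := by
    intro h
    have := Fintype.linearIndependent_iff.mp hind ![0, -a / 2, 0, 0, 1, 0]
      (by simp only [Fin.sum_univ_six, Matrix.cons_val]; rw [← h]; module) 4
    simp at this
  refine not_isSemisimple_of_commuting (v := ![(-a / 2) • X1 + X4, (-a / 2) • X2 + X5])
    t.span_eq_top ?_ ?_ (k := 0) h0
  · intro i j
    refine (Submodule.mem_span_range_iff_exists_fun ℂ).mpr
      ⟨(![![![1, 0], ![0, -1]], 0, 0, ![![3 * a / 2, 0], ![0, -(3 * a / 2)]], 0, 0] :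
        Fin 6 → Fin 2 → Fin 2 → ℂ) i j, ?_⟩
    fin_cases i <;> fin_cases j <;> simp [
      Fin.sum_univ_two, lie_add, lie_smul, lie_self, t.lie_T_X1, t.lie_T_X2, t.lie_T_X4,
      t.lie_T_X5, t.lie_X1_X2, t.lie_X1_X4, t.lie_X1_X5, t.lie_X2_X1, t.lie_X2_X4, t.lie_X2_X5,
      t.lie_X3_X1, t.lie_X3_X2, t.lie_X3_X4, t.lie_X3_X5, t.lie_X4_X1, t.lie_X4_X2, t.lie_X4_X5,
      t.lie_X5_X1, t.lie_X5_X2, t.lie_X5_X4]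
    all_goals match_scalars <;> grind
  · intro i j
    fin_cases i <;> fin_cases j <;> simp [
      lie_add, add_lie, lie_smul, smul_lie, lie_self, t.lie_X1_X2, t.lie_X1_X5, t.lie_X2_X1,
      t.lie_X2_X4, t.lie_X4_X2, t.lie_X4_X5, t.lie_X5_X1, t.lie_X5_X4]
    all_goals match_scalars <;> grind

theorem not_isSemisimple_of_sq_eq_neg (t : IsD6Table a T X1 X2 X3 X4 X5)
    (hind : LinearIndependent ℂ ![T, X1, X2, X3, X4, X5]) (ha : a ^ 2 = -9 / 4) :
    ¬ LieAlgebra.IsSemisimple ℂ L := by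
  have h0 : X3 + a • T ≠ 0 := by
    intro h
    have := Fintype.linearIndependent_iff.mp hind ![a, 0, 0, 1, 0, 0]
      (by simp only [Fin.sum_univ_six, Matrix.cons_val]; rw [← h]; module) 3
    simp at this
  refine not_isSemisimple_of_commuting
    (v := ![X3 + a • T, a • X1 + (3 : ℂ) • X4, a • X2 + (3 : ℂ) • X5])
    t.span_eq_top ?_ ?_ (k := 0) h0
  · intro i j
    refine (Submodule.mem_span_range_iff_exists_fun ℂ).mpr
      ⟨(![![0, ![0, 1, 0], ![0, 0, -1]],
          ![![0, 1, 0], 0, ![-5 * a, 0, 0]],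
          ![![0, 0, -1], ![5 * a, 0, 0], 0],
          ![0, ![0, -a, 0], ![0, 0, a]],
          ![![0, -a / 3, 0], 0, ![-15 / 4, 0, 0]],
          ![![0, 0, a / 3], ![15 / 4, 0, 0], 0]] : Fin 6 → Fin 3 → Fin 3 → ℂ) i j, ?_⟩
    fin_cases i <;> fin_cases j <;> simp [
      Fin.sum_univ_three, lie_add, lie_smul, lie_self, t.lie_T_X1, t.lie_T_X2, t.lie_T_X3,
      t.lie_T_X4, t.lie_T_X5, t.lie_X1_T, t.lie_X1_X2, t.lie_X1_X3, t.lie_X1_X4, t.lie_X1_X5,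
      t.lie_X2_T, t.lie_X2_X1, t.lie_X2_X3, t.lie_X2_X4, t.lie_X2_X5, t.lie_X3_T, t.lie_X3_X1,
      t.lie_X3_X2, t.lie_X3_X4, t.lie_X3_X5, t.lie_X4_T, t.lie_X4_X1, t.lie_X4_X2, t.lie_X4_X3,
      t.lie_X4_X5, t.lie_X5_T, t.lie_X5_X1, t.lie_X5_X2, t.lie_X5_X3, t.lie_X5_X4]
    all_goals match_scalars <;> grind
  · intro i j
    fin_cases i <;> fin_cases j <;> simp [
      lie_add, add_lie, lie_smul, smul_lie, lie_self, t.lie_T_X1, t.lie_T_X2, t.lie_T_X4,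
      t.lie_T_X5, t.lie_X1_T, t.lie_X1_X2, t.lie_X1_X3, t.lie_X1_X5, t.lie_X2_T, t.lie_X2_X1,
      t.lie_X2_X3, t.lie_X2_X4, t.lie_X3_X1, t.lie_X3_X2, t.lie_X3_X4, t.lie_X3_X5, t.lie_X4_T,
      t.lie_X4_X2, t.lie_X4_X3, t.lie_X4_X5, t.lie_X5_T, t.lie_X5_X1, t.lie_X5_X3, t.lie_X5_X4]
    all_goals match_scalars <;> grind

end IsD6Table

theorem D6_semisimple_iff (a : ℂ)
    {F : Type*} [LieRing F] [LieAlgebra ℂ F]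
    (T X1 X2 X3 X4 X5 : F)
    (hbindep : LinearIndependent ℂ ![T, X1, X2, X3, X4, X5])
    (hbspan : Submodule.span ℂ (Set.range ![T, X1, X2, X3, X4, X5]) = ⊤)
    (hb01 : ⁅T, X1⁆ = X1)
    (hb02 : ⁅T, X2⁆ = -X2)
    (hb03 : ⁅T, X3⁆ = 0)
    (hb04 : ⁅T, X4⁆ = X4)
    (hb05 : ⁅T, X5⁆ = -X5)
    (hb12 : ⁅X1, X2⁆ = (3*a) • T + (-2 : ℂ) • X3)
    (hb13 : ⁅X1, X3⁆ = (2*a) • X1 + (3 : ℂ) • X4)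
    (hb14 : ⁅X1, X4⁆ = 0)
    (hb15 : ⁅X1, X5⁆ = (6 : ℂ) • T + (-a) • X3)
    (hb23 : ⁅X2, X3⁆ = (-(2*a)) • X2 + (-3 : ℂ) • X5)
    (hb24 : ⁅X2, X4⁆ = (-6 : ℂ) • T + (a) • X3)
    (hb25 : ⁅X2, X5⁆ = 0)
    (hb34 : ⁅X3, X4⁆ = (-(a^2+3)) • X1)
    (hb35 : ⁅X3, X5⁆ = (a^2+3) • X2)
    (hb45 : ⁅X4, X5⁆ = (a*(a^2-1)) • T + (-2 : ℂ) • X3)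
    {K : Type*} [LieRing K] [LieAlgebra ℂ K]
    (H1 E1 F1 H2 E2 F2 : K)
    (hkindep : LinearIndependent ℂ ![H1, E1, F1, H2, E2, F2])
    (hkspan : Submodule.span ℂ (Set.range ![H1, E1, F1, H2, E2, F2]) = ⊤)
    (hk01 : ⁅H1, E1⁆ = (2 : ℂ) • E1)
    (hk02 : ⁅H1, F1⁆ = (-2 : ℂ) • F1)
    (hk03 : ⁅H1, H2⁆ = 0)
    (hk04 : ⁅H1, E2⁆ = 0)
    (hk05 : ⁅H1, F2⁆ = 0)
    (hk12 : ⁅E1, F1⁆ = H1)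
    (hk13 : ⁅E1, H2⁆ = 0)
    (hk14 : ⁅E1, E2⁆ = 0)
    (hk15 : ⁅E1, F2⁆ = 0)
    (hk23 : ⁅F1, H2⁆ = 0)
    (hk24 : ⁅F1, E2⁆ = 0)
    (hk25 : ⁅F1, F2⁆ = 0)
    (hk34 : ⁅H2, E2⁆ = (2 : ℂ) • E2)
    (hk35 : ⁅H2, F2⁆ = (-2 : ℂ) • F2)
    (hk45 : ⁅E2, F2⁆ = H2) :
    (LieAlgebra.IsSemisimple ℂ F ↔ (a ^ 2 ≠ -9/4 ∧ a ^ 2 ≠ 4)) ∧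
    ((a ^ 2 ≠ -9/4 ∧ a ^ 2 ≠ 4) → Nonempty (F ≃ₗ⁅ℂ⁆ K)) := by
  have tF : IsD6Table a T X1 X2 X3 X4 X5 := ⟨hb01, hb02, hb03, hb04, hb05, hb12, hb13, hb14, hb15,
    hb23, hb24, hb25, hb34, hb35, hb45, hbspan⟩
  have tK : IsSl2ProdTable H1 E1 F1 H2 E2 F2 :=
    ⟨⟨hkindep.ne_zero 0, hk12, by rw [hk01, ofNat_smul_eq_nsmul],
      by rw [hk02, neg_smul, ofNat_smul_eq_nsmul]⟩,
     ⟨hkindep.ne_zero 3, hk45, by rw [hk34, ofNat_smul_eq_nsmul],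
      by rw [hk35, neg_smul, ofNat_smul_eq_nsmul]⟩,
     hk03, hk04, hk05, hk13, hk14, hk15, hk23, hk24, hk25, hkspan⟩
  let bF : Module.Basis (Fin 6) ℂ F := Module.Basis.mk hbindep hbspan.ge
  refine ⟨⟨fun hF ↦ ⟨fun ha ↦ tF.not_isSemisimple_of_sq_eq_neg hbindep ha hF,
    fun ha ↦ tF.not_isSemisimple_of_sq_eq_four hbindep ha hF⟩, fun ⟨ha, ha'⟩ ↦ ?_⟩,
    fun ⟨ha, ha'⟩ ↦ ?_⟩
  · obtain ⟨h, e, f, h', e', f', t⟩ := tF.exists_isSl2ProdTable hbindep ha ha'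
    have := t.hasTrivialRadical
    have : Module.Finite ℂ F := Module.Finite.of_basis bF
    infer_instance
  · obtain ⟨h, e, f, h', e', f', t⟩ := tF.exists_isSl2ProdTable hbindep ha ha'
    exact t.nonempty_lieEquiv tK (linearIndependent_of_top_le_span_of_card_eq_finrank
      t.span_eq_top.ge (Module.finrank_eq_card_basis bF).symm) hkindep
end

section
/- (Existence criterion for anti-involutions of D.6_a models.) For a ∈ ℂ, let 𝔣 ⊂ 𝔤 be the span of T := −Z1+2Z2, X1 := f10 + a·e11 + e32, X2 := f11 + a·e10 + e31, X3 := f21 + (a²+1)·e21, X4 := f31 + e11 + a(a²+1/3)·e32, X5 := f32 + e10 + a(a²+1/3)·e31, equipped with the bracket [·,·]_𝔣 defined on this basis by the type D.6_a bracket table, and let 𝔭 := span{Z1, Z2, e01, f01, e10, e11, e21, e31, e32}. An anti-involution of this model is a conjugate-linear map ψ : 𝔤 → 𝔤 such that ψ∘ψ = id, ψ([x,y]) = [ψ(x), ψ(y)] for all x, y ∈ 𝔤, ψ(𝔭) = 𝔭, ψ(𝔣) = 𝔣, and ψ([x,y]_𝔣) = [ψ(x), ψ(y)]_𝔣 for all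 x, y ∈ 𝔣. Then an anti-involution of the D.6_a model exists if and only if a² ∈ ℝ. -/
set_option maxHeartbeats 1000000

noncomputable def d6c (a : ℂ) : Fin 6 → Fin 6 → Fin 6 → ℂ :=
  ![![![0, 0, 0, 0, 0, 0],
     ![0, 1, 0, 0, 0, 0],
     ![0, 0, (-1), 0, 0, 0],
     ![0, 0, 0, 0, 0, 0],
     ![0, 0, 0, 0, 1, 0],
     ![0, 0, 0, 0, 0, (-1)]],
   ![![0, (-1), 0, 0, 0, 0],
     ![0, 0, 0, 0, 0, 0],
     ![(3*a), 0, 0, (-2), 0, 0],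
     ![0, (2*a), 0, 0, 3, 0],
     ![0, 0, 0, 0, 0, 0],
     ![6, 0, 0, (-a), 0, 0]],
   ![![0, 0, 1, 0, 0, 0],
     ![(-(3*a)), 0, 0, 2, 0, 0],
     ![0, 0, 0, 0, 0, 0],
     ![0, 0, (-(2*a)), 0, 0, (-3)],
     ![(-6), 0, 0, (a), 0, 0],
     ![0, 0, 0, 0, 0, 0]],
   ![![0, 0, 0, 0, 0, 0],
     ![0, (-(2*a)), 0, 0, (-3), 0],
     ![0, 0, (-(-(2*a))), 0, 0, 3],
     ![0, 0, 0, 0, 0, 0],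
     ![0, (-(a^2+3)), 0, 0, 0, 0],
     ![0, 0, (a^2+3), 0, 0, 0]],
   ![![0, 0, 0, 0, (-1), 0],
     ![0, 0, 0, 0, 0, 0],
     ![6, 0, 0, (-(a)), 0, 0],
     ![0, (-(-(a^2+3))), 0, 0, 0, 0],
     ![0, 0, 0, 0, 0, 0],
     ![(a*(a^2-1)), 0, 0, (-2), 0, 0]],
   ![![0, 0, 0, 0, 0, 1],
     ![(-6), 0, 0, (-(-a)), 0, 0],
     ![0, 0, 0, 0, 0, 0],
     ![0, 0, (-(a^2+3)), 0, 0, 0],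
     ![(-(a*(a^2-1))), 0, 0, 2, 0, 0],
     ![0, 0, 0, 0, 0, 0]]]

noncomputable def d6br (a : ℂ) (x y : Fin 6 → ℂ) : Fin 6 → ℂ :=
  fun k => ∑ i : Fin 6, ∑ j : Fin 6, x i * y j * d6c a i j k

lemma Module.Basis.exists_semilinear_diagonal {κ M : Type*} [Fintype κ] [AddCommGroup M] [Module ℂ M]
    (B : Module.Basis κ ℂ M) (s : κ → ℂ) :
    ∃ ψ : M →ₛₗ[starRingEnd ℂ] M, ∀ i, ψ (B i) = s i • B i := by
  classical
  refine ⟨{ toFun := fun x => ∑ i, (starRingEnd ℂ (B.repr x i) * s i) • B i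
            map_add' := fun x y => ?_
            map_smul' := fun c x => ?_ }, fun i => ?_⟩
  · simp [add_mul, add_smul, Finset.sum_add_distrib]
  · simp [Finset.smul_sum, smul_smul, mul_assoc]
  · simp [Finsupp.single_apply, apply_ite, Finset.sum_ite_eq]

/-- Comparing trace and determinant of the intertwined operators `ad X3` on a weight space of `T`. -/
lemma conj_sq_eq_sq_of_intertwine {a b β p q r s : ℂ} (hdet : p * s - q * r ≠ 0)
    (h1 : -2 * b * p - 3 * r = β * (-2 * a * p - (a ^ 2 + 3) * q))
    (h2 : -2 * b * q - 3 * s = β * (-3 * p))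
    (h3 : -(b ^ 2 + 3) * p = β * (-2 * a * r - (a ^ 2 + 3) * s))
    (h4 : -(b ^ 2 + 3) * q = β * (-3 * r)) : b ^ 2 = a ^ 2 := by
  have htr : b = β * a := by
    apply mul_left_cancel₀ hdet
    linear_combination (-1/2 : ℂ) * (s * h1 - r * h2 - q * h3 + p * h4)
  have hd : b ^ 2 + 3 = β ^ 2 * (a ^ 2 + 3) := by
    apply mul_left_cancel₀ hdet
    have h5 : (-2 * b * p - 3 * r) * (-(b ^ 2 + 3) * q) - (-2 * b * q - 3 * s) * (-(b ^ 2 + 3) * p) =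
      (β * (-2 * a * p - (a ^ 2 + 3) * q)) * (β * (-3 * r))
        - (β * (-3 * p)) * (β * (-2 * a * r - (a ^ 2 + 3) * s)) := by
      rw [h1, h2, h3, h4]
    linear_combination (-1/3 : ℂ) * h5
  have hβ : β ^ 2 = 1 := by
    linear_combination (-1/3 : ℂ) * hd + (1/3 : ℂ) * (b + β * a) * htr
  rw [htr, mul_pow, hβ, one_mul]

lemma conj_sq_eq_sq_of_d6br_semilinear {a c : ℂ}
    (σ : (Fin 6 → ℂ) →ₛₗ[starRingEnd ℂ] (Fin 6 → ℂ)) (hinj : ∀ u, σ u = 0 → u = 0)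
    (hbr : ∀ u v, σ (d6br a u v) = d6br a (σ u) (σ v))
    (hT : σ ![1, 0, 0, 0, 0, 0] = ![c, 0, 0, 0, 0, 0])
    (hX3 : σ ![0, 0, 0, 1, 0, 0] 0 = 0) :
    (starRingEnd ℂ a) ^ 2 = a ^ 2 := by
  obtain ⟨w1, hw1⟩ : ∃ w, w = σ ![0, 1, 0, 0, 0, 0] := ⟨_, rfl⟩
  obtain ⟨w3, hw3⟩ : ∃ w, w = σ ![0, 0, 0, 1, 0, 0] := ⟨_, rfl⟩
  obtain ⟨w4, hw4⟩ : ∃ w, w = σ ![0, 0, 0, 0, 1, 0] := ⟨_, rfl⟩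
  have hc : c ≠ 0 := by
    rintro rfl
    have := congrFun (hinj _ (hT.trans (by ext k; fin_cases k <;> rfl))) 0
    simp at this
  have b01 : d6br a ![1, 0, 0, 0, 0, 0] ![0, 1, 0, 0, 0, 0] = ![0, 1, 0, 0, 0, 0] := by
    ext k; fin_cases k <;> simp [d6br, d6c, Fin.sum_univ_six]
  have b04 : d6br a ![1, 0, 0, 0, 0, 0] ![0, 0, 0, 0, 1, 0] = ![0, 0, 0, 0, 1, 0] := by
    ext k; fin_cases k <;> simp [d6br, d6c, Fin.sum_univ_six]
  have b03 : d6br a ![1, 0, 0, 0, 0, 0] ![0, 0, 0, 1, 0, 0] = 0 := by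
    ext k; fin_cases k <;> simp [d6br, d6c, Fin.sum_univ_six]
  have b31 : d6br a ![0, 0, 0, 1, 0, 0] ![0, 1, 0, 0, 0, 0] =
      (-2 * a) • ![0, 1, 0, 0, 0, 0] + (-3 : ℂ) • ![0, 0, 0, 0, 1, 0] := by
    ext k; fin_cases k <;> simp [d6br, d6c, Fin.sum_univ_six]
  have b34 : d6br a ![0, 0, 0, 1, 0, 0] ![0, 0, 0, 0, 1, 0] =
      (-(a ^ 2 + 3)) • ![0, 1, 0, 0, 0, 0] := by
    ext k; fin_cases k <;> simp [d6br, d6c, Fin.sum_univ_six]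
  have bT : ∀ w, d6br a ![c, 0, 0, 0, 0, 0] w = ![0, c * w 1, -(c * w 2), 0, c * w 4, -(c * w 5)] := by
    intro w
    ext k; fin_cases k <;> simp [d6br, d6c, Fin.sum_univ_six]
  have e1 := hbr ![1, 0, 0, 0, 0, 0] ![0, 1, 0, 0, 0, 0]
  have e4 := hbr ![1, 0, 0, 0, 0, 0] ![0, 0, 0, 0, 1, 0]
  have e3 := hbr ![1, 0, 0, 0, 0, 0] ![0, 0, 0, 1, 0, 0]
  have e31 := hbr ![0, 0, 0, 1, 0, 0] ![0, 1, 0, 0, 0, 0]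
  have e34 := hbr ![0, 0, 0, 1, 0, 0] ![0, 0, 0, 0, 1, 0]
  rw [b01, hT, bT, ← hw1] at e1
  rw [b04, hT, bT, ← hw4] at e4
  rw [b03, hT, bT, ← hw3, map_zero] at e3
  rw [b31, map_add, map_smulₛₗ, map_smulₛₗ, ← hw1, ← hw3, ← hw4] at e31
  rw [b34, map_smulₛₗ, ← hw1, ← hw3, ← hw4] at e34
  rw [← hw3] at hX3
  have h31 : w3 1 = 0 := by simpa [hc, eq_comm] using congrFun e3 1
  have h32 : w3 2 = 0 := by simpa [hc, eq_comm] using congrFun e3 2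
  have h34 : w3 4 = 0 := by simpa [hc, eq_comm] using congrFun e3 4
  have h35 : w3 5 = 0 := by simpa [hc, eq_comm] using congrFun e3 5
  have h10 : w1 0 = 0 := congrFun e1 0
  have h11 : w1 1 = c * w1 1 := congrFun e1 1
  have h12 : w1 2 = -(c * w1 2) := congrFun e1 2
  have h13 : w1 3 = 0 := congrFun e1 3
  have h14 : w1 4 = c * w1 4 := congrFun e1 4
  have h15 : w1 5 = -(c * w1 5) := congrFun e1 5
  have h40 : w4 0 = 0 := congrFun e4 0
  have h41 : w4 1 = c * w4 1 := congrFun e4 1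
  have h42 : w4 2 = -(c * w4 2) := congrFun e4 2
  have h43 : w4 3 = 0 := congrFun e4 3
  have h44 : w4 4 = c * w4 4 := congrFun e4 4
  have h45 : w4 5 = -(c * w4 5) := congrFun e4 5
  have hind : ∀ x y : ℂ, x • w1 + y • w4 = 0 → x = 0 ∧ y = 0 := by
    intro x y h
    have h' : σ (starRingEnd ℂ x • ![0, 1, 0, 0, 0, 0] + starRingEnd ℂ y • ![0, 0, 0, 0, 1, 0]) = 0 := by
      rw [map_add, map_smulₛₗ, map_smulₛₗ, ← hw1, ← hw4]
      simpa using h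
    have h0 := hinj _ h'
    have hx := congrFun h0 1
    have hy := congrFun h0 4
    simp at hx hy
    exact ⟨hx, hy⟩
  -- two vectors supported on coordinates `i, j` are dependent if the minor vanishes
  have hminor : ∀ i j : Fin 6, (∀ k, k ≠ i → k ≠ j → w1 k = 0 ∧ w4 k = 0) →
      w1 i * w4 j - w1 j * w4 i ≠ 0 := by
    intro i j hsupp h0
    have hj := hind (w4 j) (-w1 j) (by
      ext k
      by_cases hi : k = i
      · subst hi; simp; linear_combination h0
      by_cases hj : k = j
      · subst hj; simp; ring
      simp [(hsupp k hi hj).1, (hsupp k hi hj).2])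
    have hi := hind (w4 i) (-w1 i) (by
      ext k
      by_cases hi : k = i
      · subst hi; simp; ring
      by_cases hj : k = j
      · subst hj; simp; linear_combination -h0
      simp [(hsupp k hi hj).1, (hsupp k hi hj).2])
    have := hind 1 0 (by
      ext k
      by_cases hi' : k = i
      · subst hi'; simpa using hi.2
      by_cases hj' : k = j
      · subst hj'; simpa using hj.2
      simp [(hsupp k hi' hj').1])
    exact one_ne_zero this.1
  by_cases hc1 : c = 1
  · have z : ∀ x : ℂ, x = -(c * x) → x = 0 := fun x hx => by
      rw [hc1] at hx; linear_combination (1/2 : ℂ) * hx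
    have hdet := hminor 1 4 (by
      intro k hk1 hk4
      fin_cases k
      exacts [⟨h10, h40⟩, absurd rfl hk1, ⟨z _ h12, z _ h42⟩, ⟨h13, h43⟩, absurd rfl hk4,
        ⟨z _ h15, z _ h45⟩])
    have k1 := congrFun e31 1
    have k4 := congrFun e31 4
    have l1 := congrFun e34 1
    have l4 := congrFun e34 4
    simp [d6br, d6c, Fin.sum_univ_six, map_ofNat, hX3, h31, h32, h34, h35, h10, h13, h40, h43, z _ h12, z _ h15, z _ h42, z _ h45] at k1 k4 l1 l4
    refine conj_sq_eq_sq_of_intertwine (β := w3 3) hdet ?_ ?_ ?_ ?_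
    · linear_combination k1
    · linear_combination k4
    · linear_combination l1
    · linear_combination l4
  · have z : ∀ x : ℂ, x = c * x → x = 0 := fun x hx => by
      have : (1 - c) * x = 0 := by linear_combination hx
      exact (mul_eq_zero.mp this).resolve_left (sub_ne_zero.mpr (Ne.symm hc1))
    have hdet := hminor 2 5 (by
      intro k hk2 hk5
      fin_cases k
      exacts [⟨h10, h40⟩, ⟨z _ h11, z _ h41⟩, absurd rfl hk2, ⟨h13, h43⟩, ⟨z _ h14, z _ h44⟩,
        absurd rfl hk5])
    have k1 := congrFun e31 2
    have k4 := congrFun e31 5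
    have l1 := congrFun e34 2
    have l4 := congrFun e34 5
    simp [d6br, d6c, Fin.sum_univ_six, map_ofNat, hX3, h31, h32, h34, h35, h10, h13, h40, h43, z _ h11, z _ h14, z _ h41, z _ h44] at k1 k4 l1 l4
    refine conj_sq_eq_sq_of_intertwine (β := -w3 3) hdet ?_ ?_ ?_ ?_
    · linear_combination k1
    · linear_combination k4
    · linear_combination l1
    · linear_combination l4

lemma d6br_diagonal_conj {a t : ℂ} (ht : t = 1 ∨ t = -1) (ha : starRingEnd ℂ a = t * a)
    (u v : Fin 6 → ℂ) (k : Fin 6) :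
    d6br a (fun i => ![1, 1, t, t, t, 1] i * starRingEnd ℂ (u i))
      (fun i => ![1, 1, t, t, t, 1] i * starRingEnd ℂ (v i)) k =
    ![1, 1, t, t, t, 1] k * starRingEnd ℂ (d6br a u v k) := by
  rcases ht with rfl | rfl <;> fin_cases k <;>
    simp [d6br, d6c, Fin.sum_univ_six, ha, map_ofNat] <;> ring

theorem D6_anti_involution_exists_iff
    {g : Type*} [LieRing g] [LieAlgebra ℂ g]
    (Z1 Z2 e01 e10 e11 e21 e31 e32 f01 f10 f11 f21 f31 f32 : g)
    (hindep : LinearIndependent ℂ ![Z1, Z2, e01, e10, e11, e21, e31, e32, f01, f10, f11, f21, f31, f32])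
    (hspan : Submodule.span ℂ (Set.range ![Z1, Z2, e01, e10, e11, e21, e31, e32, f01, f10, f11, f21, f31, f32]) = ⊤)
    (hZ1Z2 : ⁅Z1, Z2⁆ = 0)
    (hZ1e01 : ⁅Z1, e01⁆ = 0)
    (hZ1e10 : ⁅Z1, e10⁆ = e10)
    (hZ1e11 : ⁅Z1, e11⁆ = e11)
    (hZ1e21 : ⁅Z1, e21⁆ = (2 : ℂ) • e21)
    (hZ1e31 : ⁅Z1, e31⁆ = (3 : ℂ) • e31)
    (hZ1e32 : ⁅Z1, e32⁆ = (3 : ℂ) • e32)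
    (hZ1f01 : ⁅Z1, f01⁆ = 0)
    (hZ1f10 : ⁅Z1, f10⁆ = -f10)
    (hZ1f11 : ⁅Z1, f11⁆ = -f11)
    (hZ1f21 : ⁅Z1, f21⁆ = (-2 : ℂ) • f21)
    (hZ1f31 : ⁅Z1, f31⁆ = (-3 : ℂ) • f31)
    (hZ1f32 : ⁅Z1, f32⁆ = (-3 : ℂ) • f32)
    (hZ2e01 : ⁅Z2, e01⁆ = e01)
    (hZ2e10 : ⁅Z2, e10⁆ = 0)
    (hZ2e11 : ⁅Z2, e11⁆ = e11)
    (hZ2e21 : ⁅Z2, e21⁆ = e21)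
    (hZ2e31 : ⁅Z2, e31⁆ = e31)
    (hZ2e32 : ⁅Z2, e32⁆ = (2 : ℂ) • e32)
    (hZ2f01 : ⁅Z2, f01⁆ = -f01)
    (hZ2f10 : ⁅Z2, f10⁆ = 0)
    (hZ2f11 : ⁅Z2, f11⁆ = -f11)
    (hZ2f21 : ⁅Z2, f21⁆ = -f21)
    (hZ2f31 : ⁅Z2, f31⁆ = -f31)
    (hZ2f32 : ⁅Z2, f32⁆ = (-2 : ℂ) • f32)
    (he01e10 : ⁅e01, e10⁆ = -e11)
    (he01e11 : ⁅e01, e11⁆ = 0)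
    (he01e21 : ⁅e01, e21⁆ = 0)
    (he01e31 : ⁅e01, e31⁆ = e32)
    (he01e32 : ⁅e01, e32⁆ = 0)
    (he01f01 : ⁅e01, f01⁆ = -Z1 + (2 : ℂ) • Z2)
    (he01f10 : ⁅e01, f10⁆ = 0)
    (he01f11 : ⁅e01, f11⁆ = f10)
    (he01f21 : ⁅e01, f21⁆ = 0)
    (he01f31 : ⁅e01, f31⁆ = 0)
    (he01f32 : ⁅e01, f32⁆ = -f31)
    (he10e11 : ⁅e10, e11⁆ = (2 : ℂ) • e21)
    (he10e21 : ⁅e10, e21⁆ = (-3 : ℂ) • e31)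
    (he10e31 : ⁅e10, e31⁆ = 0)
    (he10e32 : ⁅e10, e32⁆ = 0)
    (he10f01 : ⁅e10, f01⁆ = 0)
    (he10f10 : ⁅e10, f10⁆ = (2 : ℂ) • Z1 + (-3 : ℂ) • Z2)
    (he10f11 : ⁅e10, f11⁆ = (-3 : ℂ) • f01)
    (he10f21 : ⁅e10, f21⁆ = (-2 : ℂ) • f11)
    (he10f31 : ⁅e10, f31⁆ = f21)
    (he10f32 : ⁅e10, f32⁆ = 0)
    (he11e21 : ⁅e11, e21⁆ = (3 : ℂ) • e32)
    (he11e31 : ⁅e11, e31⁆ = 0)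
    (he11e32 : ⁅e11, e32⁆ = 0)
    (he11f01 : ⁅e11, f01⁆ = e10)
    (he11f10 : ⁅e11, f10⁆ = (-3 : ℂ) • e01)
    (he11f11 : ⁅e11, f11⁆ = -Z1 + (3 : ℂ) • Z2)
    (he11f21 : ⁅e11, f21⁆ = (2 : ℂ) • f10)
    (he11f31 : ⁅e11, f31⁆ = 0)
    (he11f32 : ⁅e11, f32⁆ = -f21)
    (he21e31 : ⁅e21, e31⁆ = 0)
    (he21e32 : ⁅e21, e32⁆ = 0)
    (he21f01 : ⁅e21, f01⁆ = 0)
    (he21f10 : ⁅e21, f10⁆ = (-2 : ℂ) • e11)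
    (he21f11 : ⁅e21, f11⁆ = (2 : ℂ) • e10)
    (he21f21 : ⁅e21, f21⁆ = Z1)
    (he21f31 : ⁅e21, f31⁆ = -f10)
    (he21f32 : ⁅e21, f32⁆ = f11)
    (he31e32 : ⁅e31, e32⁆ = 0)
    (he31f01 : ⁅e31, f01⁆ = 0)
    (he31f10 : ⁅e31, f10⁆ = e21)
    (he31f11 : ⁅e31, f11⁆ = 0)
    (he31f21 : ⁅e31, f21⁆ = -e10)
    (he31f31 : ⁅e31, f31⁆ = Z1 + -Z2)
    (he31f32 : ⁅e31, f32⁆ = f01)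
    (he32f01 : ⁅e32, f01⁆ = -e31)
    (he32f10 : ⁅e32, f10⁆ = 0)
    (he32f11 : ⁅e32, f11⁆ = -e21)
    (he32f21 : ⁅e32, f21⁆ = e11)
    (he32f31 : ⁅e32, f31⁆ = e01)
    (he32f32 : ⁅e32, f32⁆ = Z2)
    (hf01f10 : ⁅f01, f10⁆ = f11)
    (hf01f11 : ⁅f01, f11⁆ = 0)
    (hf01f21 : ⁅f01, f21⁆ = 0)
    (hf01f31 : ⁅f01, f31⁆ = -f32)
    (hf01f32 : ⁅f01, f32⁆ = 0)
    (hf10f11 : ⁅f10, f11⁆ = (-2 : ℂ) • f21)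
    (hf10f21 : ⁅f10, f21⁆ = (3 : ℂ) • f31)
    (hf10f31 : ⁅f10, f31⁆ = 0)
    (hf10f32 : ⁅f10, f32⁆ = 0)
    (hf11f21 : ⁅f11, f21⁆ = (-3 : ℂ) • f32)
    (hf11f31 : ⁅f11, f31⁆ = 0)
    (hf11f32 : ⁅f11, f32⁆ = 0)
    (hf21f31 : ⁅f21, f31⁆ = 0)
    (hf21f32 : ⁅f21, f32⁆ = 0)
    (hf31f32 : ⁅f31, f32⁆ = 0)
    (a : ℂ) (T X1 X2 X3 X4 X5 : g)
    (hT : T = -Z1 + (2 : ℂ) • Z2)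
    (hX1 : X1 = f10 + a • e11 + e32)
    (hX2 : X2 = f11 + a • e10 + e31)
    (hX3 : X3 = f21 + (a ^ 2 + 1) • e21)
    (hX4 : X4 = f31 + e11 + (a * (a ^ 2 + 1/3)) • e32)
    (hX5 : X5 = f32 + e10 + (a * (a ^ 2 + 1/3)) • e31)
    (ι : (Fin 6 → ℂ) → g)
    (hι : ∀ v, ι v = ∑ i : Fin 6, v i • ![T, X1, X2, X3, X4, X5] i)
    (P : Submodule ℂ g)
    (hP : P = Submodule.span ℂ ({Z1, Z2, e01, f01, e10, e11, e21, e31, e32} : Set g))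
    (Fm : Submodule ℂ g)
    (hFm : Fm = Submodule.span ℂ ({T, X1, X2, X3, X4, X5} : Set g)) :
    (∃ ψ : g →ₛₗ[starRingEnd ℂ] g,
      (∀ x, ψ (ψ x) = x) ∧
      (∀ x y : g, ψ ⁅x, y⁆ = ⁅ψ x, ψ y⁆) ∧
      ψ '' (P : Set g) = (P : Set g) ∧
      ψ '' (Fm : Set g) = (Fm : Set g) ∧
      (∀ u v u' v' : Fin 6 → ℂ, ψ (ι u) = ι u' → ψ (ι v) = ι v' →
        ψ (ι (d6br a u v)) = ι (d6br a u' v'))) ↔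
    (∃ r : ℝ, a ^ 2 = (r : ℂ)) := by
  set b : Fin 14 → g :=
    ![Z1, Z2, e01, e10, e11, e21, e31, e32, f01, f10, f11, f21, f31, f32] with hb
  obtain ⟨B, hB⟩ : ∃ B : Module.Basis (Fin 14) ℂ g, ⇑B = b :=
    ⟨Module.Basis.mk hindep hspan.ge, Module.Basis.coe_mk _ _⟩
  have hcoord : ∀ i j, B.repr (b i) j = if i = j then 1 else 0 := fun i j => by
    rw [← hB, B.repr_self, Finsupp.single_apply]
  have cZ1 : ∀ j, B.repr Z1 j = if 0 = j then 1 else 0 := hcoord 0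
  have cZ2 : ∀ j, B.repr Z2 j = if 1 = j then 1 else 0 := hcoord 1
  have ce01 : ∀ j, B.repr e01 j = if 2 = j then 1 else 0 := hcoord 2
  have ce10 : ∀ j, B.repr e10 j = if 3 = j then 1 else 0 := hcoord 3
  have ce11 : ∀ j, B.repr e11 j = if 4 = j then 1 else 0 := hcoord 4
  have ce21 : ∀ j, B.repr e21 j = if 5 = j then 1 else 0 := hcoord 5
  have ce31 : ∀ j, B.repr e31 j = if 6 = j then 1 else 0 := hcoord 6
  have ce32 : ∀ j, B.repr e32 j = if 7 = j then 1 else 0 := hcoord 7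
  have cf01 : ∀ j, B.repr f01 j = if 8 = j then 1 else 0 := hcoord 8
  have cf10 : ∀ j, B.repr f10 j = if 9 = j then 1 else 0 := hcoord 9
  have cf11 : ∀ j, B.repr f11 j = if 10 = j then 1 else 0 := hcoord 10
  have cf21 : ∀ j, B.repr f21 j = if 11 = j then 1 else 0 := hcoord 11
  have cf31 : ∀ j, B.repr f31 j = if 12 = j then 1 else 0 := hcoord 12
  have cf32 : ∀ j, B.repr f32 j = if 13 = j then 1 else 0 := hcoord 13
  have hι' : ∀ v, ι v = v 0 • T + v 1 • X1 + v 2 • X2 + v 3 • X3 + v 4 • X4 + v 5 • X5 := fun v => by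
    rw [hι, Fin.sum_univ_six]; rfl
  have hιadd : ∀ u v, ι (u + v) = ι u + ι v := fun u v => by
    simp only [hι', Pi.add_apply]; module
  have hιsmul : ∀ (c : ℂ) v, ι (c • v) = c • ι v := fun c v => by
    simp only [hι', Pi.smul_apply, smul_eq_mul]; module
  have ι1 : ∀ v, B.repr (ι v) 1 = 2 * v 0 := fun v => by
    simp [hι', hT, hX1, hX2, hX3, hX4, hX5, cZ1, cZ2, ce10, ce11, ce21, ce31, ce32, cf10, cf11,
      cf21, cf31, cf32]; ring
  have ι9 : ∀ v, B.repr (ι v) 9 = v 1 := fun v => by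
    simp [hι', hT, hX1, hX2, hX3, hX4, hX5, cZ1, cZ2, ce10, ce11, ce21, ce31, ce32, cf10, cf11,
      cf21, cf31, cf32]
  have ι10 : ∀ v, B.repr (ι v) 10 = v 2 := fun v => by
    simp [hι', hT, hX1, hX2, hX3, hX4, hX5, cZ1, cZ2, ce10, ce11, ce21, ce31, ce32, cf10, cf11,
      cf21, cf31, cf32]
  have ι11 : ∀ v, B.repr (ι v) 11 = v 3 := fun v => by
    simp [hι', hT, hX1, hX2, hX3, hX4, hX5, cZ1, cZ2, ce10, ce11, ce21, ce31, ce32, cf10, cf11,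
      cf21, cf31, cf32]
  have ι12 : ∀ v, B.repr (ι v) 12 = v 4 := fun v => by
    simp [hι', hT, hX1, hX2, hX3, hX4, hX5, cZ1, cZ2, ce10, ce11, ce21, ce31, ce32, cf10, cf11,
      cf21, cf31, cf32]
  have ι13 : ∀ v, B.repr (ι v) 13 = v 5 := fun v => by
    simp [hι', hT, hX1, hX2, hX3, hX4, hX5, cZ1, cZ2, ce10, ce11, ce21, ce31, ce32, cf10, cf11,
      cf21, cf31, cf32]
  have hιinj : ∀ u v, ι u = ι v → u = v := by
    intro u v h
    ext k
    fin_cases k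
    · have := ι1 u; rw [h, ι1] at this; exact (mul_left_cancel₀ two_ne_zero this).symm
    · exact (ι9 u).symm.trans (h ▸ ι9 v)
    · exact (ι10 u).symm.trans (h ▸ ι10 v)
    · exact (ι11 u).symm.trans (h ▸ ι11 v)
    · exact (ι12 u).symm.trans (h ▸ ι12 v)
    · exact (ι13 u).symm.trans (h ▸ ι13 v)
  have hιF : ∀ v, ι v ∈ Fm := by
    intro v
    have hm : ∀ x ∈ ({T, X1, X2, X3, X4, X5} : Set g), x ∈ Fm := fun x hx =>
      hFm ▸ Submodule.subset_span hx
    rw [hι']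
    refine add_mem (add_mem (add_mem (add_mem (add_mem ?_ ?_) ?_) ?_) ?_) ?_ <;>
      exact Fm.smul_mem _ (hm _ (by simp))
  have hFι : ∀ x ∈ Fm, ∃ v, x = ι v := by
    intro x hx
    rw [hFm] at hx
    induction hx using Submodule.span_induction with
    | mem x hx =>
      rcases hx with rfl | rfl | rfl | rfl | rfl | rfl
      · exact ⟨![1, 0, 0, 0, 0, 0], by simp [hι']⟩
      · exact ⟨![0, 1, 0, 0, 0, 0], by simp [hι']⟩
      · exact ⟨![0, 0, 1, 0, 0, 0], by simp [hι']⟩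
      · exact ⟨![0, 0, 0, 1, 0, 0], by simp [hι']⟩
      · exact ⟨![0, 0, 0, 0, 1, 0], by simp [hι']⟩
      · exact ⟨![0, 0, 0, 0, 0, 1], by simp [hι']⟩
    | zero => exact ⟨0, by simp [hι']⟩
    | add x y _ _ hx hy =>
      obtain ⟨u, rfl⟩ := hx
      obtain ⟨v, rfl⟩ := hy
      exact ⟨u + v, (hιadd u v).symm⟩
    | smul c x _ hx =>
      obtain ⟨u, rfl⟩ := hx
      exact ⟨c • u, (hιsmul c u).symm⟩
  constructor
  · rintro ⟨ψ, hinv, hlie, hψP, hψF, hψbr⟩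
    have hψinj : ∀ x, ψ x = 0 → x = 0 := fun x hx => by
      rw [← hinv x, hx, map_zero]
    have hex : ∀ u, ∃ u', ψ (ι u) = ι u' := fun u =>
      hFι _ (hψF.subset ⟨_, hιF u, rfl⟩)
    choose τ hτ using hex
    let σ : (Fin 6 → ℂ) →ₛₗ[starRingEnd ℂ] (Fin 6 → ℂ) :=
      { toFun := τ
        map_add' := fun u v => hιinj _ _ (by rw [← hτ, hιadd, hιadd, map_add, hτ, hτ])
        map_smul' := fun c u => hιinj _ _ (by rw [← hτ, hιsmul, hιsmul, map_smulₛₗ, hτ]) }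
    have hσ : ∀ u, ψ (ι u) = ι (σ u) := hτ
    have hιT : ι ![1, 0, 0, 0, 0, 0] = T := by simp [hι']
    have hιX3 : ι ![0, 0, 0, 1, 0, 0] = X3 := by simp [hι']
    have hTP : ψ T ∈ P := by
      refine hψP.subset ⟨T, ?_, rfl⟩
      have hm : ∀ x ∈ ({Z1, Z2, e01, f01, e10, e11, e21, e31, e32} : Set g), x ∈ P := fun x hx =>
        hP ▸ Submodule.subset_span hx
      rw [hT]
      exact add_mem (neg_mem (hm _ (by simp))) (P.smul_mem _ (hm _ (by simp)))
    have hPcoord : ∀ j : Fin 14, 9 ≤ j → ∀ x ∈ P, B.repr x j = 0 := by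
      intro j hj x hx
      have : P ≤ LinearMap.ker (B.coord j) := by
        rw [hP, Submodule.span_le]
        rintro y (rfl | rfl | rfl | rfl | rfl | rfl | rfl | rfl | rfl) <;>
          simp only [SetLike.mem_coe, LinearMap.mem_ker, Module.Basis.coord_apply, cZ1, cZ2, ce01, ce10, ce11,
            ce21, ce31, ce32, cf01] <;>
          exact if_neg (by rintro rfl; exact absurd hj (by decide))
      exact this hx
    rw [← hιT, hσ] at hTP
    have hσT : σ ![1, 0, 0, 0, 0, 0] = ![σ ![1, 0, 0, 0, 0, 0] 0, 0, 0, 0, 0, 0] := by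
      ext k
      fin_cases k
      · rfl
      · exact (ι9 _).symm.trans (hPcoord 9 (by decide) _ hTP)
      · exact (ι10 _).symm.trans (hPcoord 10 (by decide) _ hTP)
      · exact (ι11 _).symm.trans (hPcoord 11 (by decide) _ hTP)
      · exact (ι12 _).symm.trans (hPcoord 12 (by decide) _ hTP)
      · exact (ι13 _).symm.trans (hPcoord 13 (by decide) _ hTP)
    obtain ⟨c, hc⟩ : ∃ c, c = σ ![1, 0, 0, 0, 0, 0] 0 := ⟨_, rfl⟩
    rw [← hc] at hσT
    have hψT : ψ T = c • T := by
      rw [← hιT, hσ, hσT, ← hιsmul]; congr 1; ext k; fin_cases k <;> simp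
    have hT0 : T ≠ 0 := by
      intro h
      have := ι1 ![1, 0, 0, 0, 0, 0]
      simp [hιT, h] at this
    have hc0 : c ≠ 0 := by
      rintro rfl
      exact hT0 (hψinj _ (by rw [hψT, zero_smul]))
    have hexp : ∀ x, x = ∑ i, B.repr x i • b i := fun x => by
      rw [← hB]; exact (B.sum_repr x).symm
    -- the centralizer of `T` is spanned by `Z1, Z2, e21, f21`
    have hker : ∀ x, ⁅T, x⁆ = 0 →
        ∃ x0 x1 x5 x11 : ℂ, x = x0 • Z1 + x1 • Z2 + x5 • e21 + x11 • f21 := by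
      intro x hx
      have hxe := hexp x
      have hlin : ∀ i, B.repr ⁅T, x⁆ i = ![0, 0, 2, -1, 1, 0, -1, 1, -2, 1, -1, 0, 1, -1] i * B.repr x i := by
        have hTb : ∀ i, ⁅T, b i⁆ = (![0, 0, 2, -1, 1, 0, -1, 1, -2, 1, -1, 0, 1, -1] i : ℂ) • b i := by
          have hZ2Z1 : ⁅Z2, Z1⁆ = 0 := by rw [← lie_skew, hZ1Z2, neg_zero]
          intro i
          fin_cases i <;> simp [hb, hT, hZ1Z2, hZ2Z1, hZ1e01, hZ1e10, hZ1e11, hZ1e21, hZ1e31, hZ1e32, hZ1f01, hZ1f10, hZ1f11, hZ1f21,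
            hZ1f31, hZ1f32, hZ2e01, hZ2e10, hZ2e11, hZ2e21, hZ2e31, hZ2e32, hZ2f01, hZ2f10,
            hZ2f11, hZ2f21, hZ2f31, hZ2f32] <;> module
        intro i
        conv_lhs => rw [hxe, lie_sum]
        simp only [lie_smul, hTb, map_sum, map_smul, Finsupp.coe_finsetSum, Finset.sum_apply, Finsupp.smul_apply, hcoord]
        simp [mul_comm]
      simp only [hx, map_zero, Finsupp.coe_zero, Pi.zero_apply] at hlin
      have z : ∀ i, (![0, 0, 2, -1, 1, 0, -1, 1, -2, 1, -1, 0, 1, -1] i : ℂ) ≠ 0 → B.repr x i = 0 :=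
        fun i hi => ((mul_eq_zero.mp (hlin i).symm).resolve_left hi)
      refine ⟨B.repr x 0, B.repr x 1, B.repr x 5, B.repr x 11, ?_⟩
      conv_lhs => rw [hxe]
      simp [Fin.sum_univ_succ, hb, z 2 (by simp), z 3 (by simp), z 4 (by simp), z 6 (by simp),
        z 7 (by simp), z 8 (by simp), z 9 (by simp), z 10 (by simp), z 12 (by simp), z 13 (by simp),
        add_assoc]
    have hψker : ∀ x, ⁅T, x⁆ = 0 → ⁅T, ψ x⁆ = 0 := by
      intro x hx
      have h := hlie T x
      rw [hx, map_zero, hψT, smul_lie] at h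
      exact (smul_eq_zero.mp h.symm).resolve_left hc0
    have hX3lie : X3 = ⁅Z1, (-1/2 : ℂ) • f21 + ((a ^ 2 + 1) / 2) • e21⁆ := by
      rw [hX3, lie_add, lie_smul, lie_smul, hZ1f21, hZ1e21]; module
    have hZ2Z1 : ⁅Z2, Z1⁆ = 0 := by rw [← lie_skew, hZ1Z2, neg_zero]
    obtain ⟨x0, x1, x5, x11, hx⟩ := hker _ (hψker Z1 (by simp [hT, hZ2Z1]))
    obtain ⟨y0, y1, y5, y11, hy⟩ := hker _ (hψker ((-1/2 : ℂ) • f21 + ((a ^ 2 + 1) / 2) • e21) (by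
      simp [hT, hZ1f21, hZ1e21, hZ2f21, hZ2e21]))
    have hσX3 : σ ![0, 0, 0, 1, 0, 0] 0 = 0 := by
      have h := ι1 (σ ![0, 0, 0, 1, 0, 0])
      have r1 : ⁅e21, Z1⁆ = -((2 : ℂ) • e21) := by rw [← lie_skew, hZ1e21]
      have r2 : ⁅e21, Z2⁆ = -e21 := by rw [← lie_skew, hZ2e21]
      have r3 : ⁅f21, Z1⁆ = -((-2 : ℂ) • f21) := by rw [← lie_skew, hZ1f21]
      have r4 : ⁅f21, Z2⁆ = f21 := by rw [← lie_skew, hZ2f21, neg_neg]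
      have r5 : ⁅f21, e21⁆ = -Z1 := by rw [← lie_skew, he21f21]
      rw [← hσ, hιX3, hX3lie, hlie, hx, hy] at h
      simp [hZ1Z2, hZ2Z1, hZ1e21, hZ2e21, hZ1f21, hZ2f21, he21f21, r1, r2, r3, r4, r5,
        cZ1, ce21, cf21] at h
      exact h
    have hmain := conj_sq_eq_sq_of_d6br_semilinear σ
      (fun u hu => by
        have hz : ι 0 = 0 := by simp [hι']
        exact hιinj _ _ ((hψinj _ (by rw [hσ, hu, hz])).trans hz.symm))
      (fun u v => hιinj _ _ (by rw [← hσ, hψbr u v _ _ (hσ u) (hσ v)])) hσT hσX3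
    rw [← map_pow] at hmain
    exact Complex.conj_eq_iff_real.mp hmain
  · rintro ⟨r, hr⟩
    obtain ⟨t, ht, hat⟩ : ∃ t : ℂ, (t = 1 ∨ t = -1) ∧ starRingEnd ℂ a = t * a := by
      have : (starRingEnd ℂ a) ^ 2 = a ^ 2 := by rw [← map_pow, hr, Complex.conj_ofReal]
      rcases sq_eq_sq_iff_eq_or_eq_neg.mp this with h | h
      · exact ⟨1, Or.inl rfl, by rw [h, one_mul]⟩
      · exact ⟨-1, Or.inr rfl, by rw [h, neg_one_mul]⟩
    obtain ⟨ψ, hψ⟩ := B.exists_semilinear_diagonal ![1, 1, t, 1, t, t, t, 1, t, 1, t, t, t, 1]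
    rw [hB] at hψ
    have pZ1 : ψ Z1 = Z1 := (hψ 0).trans (one_smul _ _)
    have pZ2 : ψ Z2 = Z2 := (hψ 1).trans (one_smul _ _)
    have pe01 : ψ e01 = t • e01 := hψ 2
    have pe10 : ψ e10 = e10 := (hψ 3).trans (one_smul _ _)
    have pe11 : ψ e11 = t • e11 := hψ 4
    have pe21 : ψ e21 = t • e21 := hψ 5
    have pe31 : ψ e31 = t • e31 := hψ 6
    have pe32 : ψ e32 = e32 := (hψ 7).trans (one_smul _ _)
    have pf01 : ψ f01 = t • f01 := hψ 8
    have pf10 : ψ f10 = f10 := (hψ 9).trans (one_smul _ _)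
    have pf11 : ψ f11 = t • f11 := hψ 10
    have pf21 : ψ f21 = t • f21 := hψ 11
    have pf31 : ψ f31 = t • f31 := hψ 12
    have pf32 : ψ f32 = f32 := (hψ 13).trans (one_smul _ _)
    have htt : t * t = 1 := by rcases ht with rfl | rfl <;> norm_num
    have htc : starRingEnd ℂ t = t := by rcases ht with rfl | rfl <;> simp
    have htop : ∀ x : g, x ∈ Submodule.span ℂ (Set.range b) := fun x => hspan ▸ Submodule.mem_top
    have hinv : ∀ x, ψ (ψ x) = x := by
      intro x
      induction htop x using Submodule.span_induction with
      | mem x hx =>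
        obtain ⟨i, rfl⟩ := hx
        rw [hψ, map_smulₛₗ, hψ, smul_smul]
        fin_cases i <;> simp [htc, htt]
      | zero => simp
      | add x y _ _ hx hy => rw [map_add, map_add, hx, hy]
      | smul c x _ hx => rw [map_smulₛₗ, map_smulₛₗ, hx, Complex.conj_conj]
    have himage : ∀ S : Submodule ℂ g, (∀ x ∈ S, ψ x ∈ S) → ψ '' (S : Set g) = (S : Set g) := by
      intro S hS
      refine Set.Subset.antisymm ?_ fun x hx => ⟨ψ x, hS x hx, hinv x⟩
      rintro _ ⟨x, hx, rfl⟩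
      exact hS x hx
    have hψι : ∀ u, ψ (ι u) = ι (fun i => ![1, 1, t, t, t, 1] i * starRingEnd ℂ (u i)) := by
      intro u
      rcases ht with rfl | rfl <;>
      simp only [hι', hT, hX1, hX2, hX3, hX4, hX5, map_add, map_neg, map_smulₛₗ, pZ1, pZ2, pe10, pe11,
        pe21, pe31, pe32, pf10, pf11, pf21, pf31, pf32] <;>
      simp [hat, map_ofNat]
    refine ⟨ψ, hinv, ?_, himage P ?_, himage Fm ?_, ?_⟩
    · have hbasis : ∀ i j, i < j → ψ ⁅b i, b j⁆ = ⁅ψ (b i), ψ (b j)⁆ := by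
        intro i j hij
        rcases ht with rfl | rfl <;> fin_cases i <;> fin_cases j <;>
          first
          | exact absurd hij (by decide)
          | simp [hb, map_ofNat, pZ1, pZ2, pe01, pe10, pe11, pe21, pe31, pe32, pf01, pf10, pf11, pf21,
              pf31, pf32, hZ1Z2, hZ1e01, hZ1e10, hZ1e11, hZ1e21, hZ1e31, hZ1e32, hZ1f01, hZ1f10, hZ1f11,
              hZ1f21, hZ1f31, hZ1f32, hZ2e01, hZ2e10, hZ2e11, hZ2e21, hZ2e31, hZ2e32, hZ2f01,
              hZ2f10, hZ2f11, hZ2f21, hZ2f31, hZ2f32, he01e10, he01e11, he01e21, he01e31,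
              he01e32, he01f01, he01f10, he01f11, he01f21, he01f31, he01f32, he10e11, he10e21,
              he10e31, he10e32, he10f01, he10f10, he10f11, he10f21, he10f31, he10f32, he11e21,
              he11e31, he11e32, he11f01, he11f10, he11f11, he11f21, he11f31, he11f32, he21e31,
              he21e32, he21f01, he21f10, he21f11, he21f21, he21f31, he21f32, he31e32, he31f01,
              he31f10, he31f11, he31f21, he31f31, he31f32, he32f01, he32f10, he32f11, he32f21,
              he32f31, he32f32, hf01f10, hf01f11, hf01f21, hf01f31, hf01f32, hf10f11, hf10f21,
              hf10f31, hf10f32, hf11f21, hf11f31, hf11f32, hf21f31, hf21f32, hf31f32]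
      have hbasis' : ∀ i j, ψ ⁅b i, b j⁆ = ⁅ψ (b i), ψ (b j)⁆ := by
        intro i j
        rcases lt_trichotomy i j with h | rfl | h
        · exact hbasis i j h
        · simp
        · rw [← lie_skew, map_neg, hbasis j i h, lie_skew]
      intro x y
      induction htop x using Submodule.span_induction with
      | mem x hx =>
        obtain ⟨i, rfl⟩ := hx
        induction htop y using Submodule.span_induction with
        | mem y hy =>
          obtain ⟨j, rfl⟩ := hy
          exact hbasis' i j
        | zero => simp
        | add y z _ _ hy hz => rw [lie_add, map_add, map_add, lie_add, hy, hz]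
        | smul c y _ hy => rw [lie_smul, map_smulₛₗ, map_smulₛₗ, lie_smul, hy]
      | zero => simp
      | add x z _ _ hx hz => rw [add_lie, map_add, map_add, add_lie, hx, hz]
      | smul c x _ hx => rw [smul_lie, map_smulₛₗ, map_smulₛₗ, smul_lie, hx]
    · have : P ≤ P.comap ψ := by
        nth_rw 1 [hP]
        rw [Submodule.span_le]
        have hm : ∀ x ∈ ({Z1, Z2, e01, f01, e10, e11, e21, e31, e32} : Set g), x ∈ P := fun x hx =>
          hP ▸ Submodule.subset_span hx
        rintro y (rfl | rfl | rfl | rfl | rfl | rfl | rfl | rfl | rfl) <;>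
          simp only [SetLike.mem_coe, Submodule.mem_comap, pZ1, pZ2, pe01, pe10, pe11, pe21, pe31, pe32, pf01] <;>
          first
          | exact P.smul_mem _ (hm _ (by simp))
          | exact hm _ (by simp)
      exact fun x hx => this hx
    · intro x hx
      obtain ⟨v, rfl⟩ := hFι x hx
      rw [hψι]
      exact hιF _
    · intro u v u' v' hu hv
      rw [hψι] at hu hv ⊢
      rw [← hιinj _ _ hu, ← hιinj _ _ hv]
      congr 1
      ext k
      exact (d6br_diagonal_conj ht hat u v k).symm
end

section
/- (Real forms of D.6_a fixed by the anti-involution ψ̃₋₁.) For a ∈ ℝ, regard the complex Lie algebra 𝔣_a as a real Lie algebra by restriction of scalars. The real span 𝔥 of the six elements i·T, X1−X2, i·(X1+X2), i·X3, X4−X5, i·(X4+X5) is a 6-dimensional real Lie subalgebra of 𝔣_a. If a > 2 then 𝔥 is isomorphic to so(3) × so(3); if 0 < a < 2 then 𝔥 is isomorphic to sl(2,ℝ) × so(3). Here so(3) denotes the real Lie algebra with basis A, B, C and brackets [A,B]=C, [B,C]=A, [C,A]=B. -/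
/-- Restriction of scalars of a complex Lie algebra to the reals. -/
abbrev LieAlgebra.complexToReal (L : Type*) [LieRing L] [LieAlgebra ℂ L] : LieAlgebra ℝ L where
  toModule := Module.complexToReal L
  lie_smul r x y := lie_smul (r : ℂ) x y

theorem linearIndependent_of_span_range_eq {ι V : Type*} [Fintype ι] [AddCommGroup V]
    [Module ℝ V] {v w : ι → V} (hv : LinearIndependent ℝ v)
    (h : Submodule.span ℝ (Set.range w) = Submodule.span ℝ (Set.range v)) :
    LinearIndependent ℝ w := by
  rw [linearIndependent_iff_card_eq_finrank_span] at hv ⊢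
  rw [hv, Set.finrank, Set.finrank, h]

section RealLieAlgebra

variable {L : Type*} [LieRing L] [LieAlgebra ℝ L]

theorem lie_mem_of_mem_span {s t : Set L} {N : Submodule ℝ L}
    (h : ∀ x ∈ s, ∀ y ∈ t, ⁅x, y⁆ ∈ N) {x y : L}
    (hx : x ∈ Submodule.span ℝ s) (hy : y ∈ Submodule.span ℝ t) : ⁅x, y⁆ ∈ N := by
  induction hx, hy using Submodule.span_induction₂ with
  | mem_mem x y hx hy => exact h x hx y hy
  | zero_left => simp
  | zero_right => simp
  | add_left x y z _ _ _ h₁ h₂ => rw [add_lie]; exact N.add_mem h₁ h₂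
  | add_right x y z _ _ _ h₁ h₂ => rw [lie_add]; exact N.add_mem h₁ h₂
  | smul_left r x y _ _ h => rw [smul_lie]; exact N.smul_mem r h
  | smul_right r x y _ _ h => rw [lie_smul]; exact N.smul_mem r h

/-- For `k > 0` such a triple spans a copy of `so(3)`, for `k < 0` a copy of `sl(2, ℝ)`. -/
structure IsRotationTriple (k : ℝ) (P Q R : L) : Prop where
  lie_PQ : ⁅P, Q⁆ = (2 : ℝ) • R
  lie_RP : ⁅R, P⁆ = k • Q
  lie_QR : ⁅Q, R⁆ = k • P

namespace IsRotationTriple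

variable {k : ℝ} {P Q R : L}

theorem exists_so3_basis (h : IsRotationTriple k P Q R) (hk : 0 < k) :
    ∃ A B C : L, Submodule.span ℝ {A, B, C} = Submodule.span ℝ {P, Q, R} ∧
      ⁅A, B⁆ = C ∧ ⁅A, C⁆ = -B ∧ ⁅B, C⁆ = A := by
  obtain ⟨r, hr, hrk⟩ : ∃ r : ℝ, r ≠ 0 ∧ 2 * k * r ^ 2 = 1 :=
    ⟨√(1 / (2 * k)), by positivity, by rw [Real.sq_sqrt (by positivity)]; field_simp⟩
  have hPR : ⁅P, R⁆ = (-k) • Q := by rw [← lie_skew, h.lie_RP, neg_smul]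
  refine ⟨r • P, r • Q, (2 * r ^ 2) • R, le_antisymm ?_ ?_, ?_, ?_, ?_⟩
  · simp only [Submodule.span_le, Set.insert_subset_iff, Set.singleton_subset_iff,
      SetLike.mem_coe]
    refine ⟨?_, ?_, ?_⟩ <;> exact Submodule.smul_mem _ _ (Submodule.subset_span (by simp))
  · simp only [Submodule.span_le, Set.insert_subset_iff, Set.singleton_subset_iff,
      SetLike.mem_coe]
    refine ⟨?_, ?_, ?_⟩
    · exact (Submodule.smul_mem_iff _ hr).1 (Submodule.subset_span (by simp))
    · exact (Submodule.smul_mem_iff _ hr).1 (Submodule.subset_span (by simp))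
    · exact (Submodule.smul_mem_iff _ (s := 2 * r ^ 2) (by positivity)).1
        (Submodule.subset_span (by simp))
  · simp only [smul_lie, lie_smul, h.lie_PQ]
    module
  · simp only [smul_lie, lie_smul, hPR]
    match_scalars
    linear_combination -r * hrk
  · simp only [smul_lie, lie_smul, h.lie_QR]
    match_scalars
    linear_combination r * hrk

theorem exists_sl2_basis (h : IsRotationTriple k P Q R) (hk : k < 0) :
    ∃ H X Y : L, Submodule.span ℝ {H, X, Y} = Submodule.span ℝ {P, Q, R} ∧
      ⁅H, X⁆ = (2 : ℝ) • X ∧ ⁅H, Y⁆ = (-2 : ℝ) • Y ∧ ⁅X, Y⁆ = H := by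
  obtain ⟨t, ht, rfl⟩ : ∃ t : ℝ, t ≠ 0 ∧ k = -(2 / t ^ 2) :=
    ⟨√(2 / -k), (Real.sqrt_pos.2 (div_pos two_pos (neg_pos.2 hk))).ne', by
      rw [Real.sq_sqrt (div_pos two_pos (neg_pos.2 hk)).le]; field_simp⟩
  have hPR : ⁅P, R⁆ = (2 / t ^ 2) • Q := by rw [← lie_skew, h.lie_RP]; module
  have hRQ : ⁅R, Q⁆ = (2 / t ^ 2) • P := by rw [← lie_skew, h.lie_QR]; module
  refine ⟨t • P, Q + t • R, (t ^ 2 / 4) • (Q - t • R), le_antisymm ?_ ?_, ?_, ?_, ?_⟩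
  · have hP : P ∈ Submodule.span ℝ {P, Q, R} := Submodule.subset_span (by simp)
    have hQ : Q ∈ Submodule.span ℝ {P, Q, R} := Submodule.subset_span (by simp)
    have hR : R ∈ Submodule.span ℝ {P, Q, R} := Submodule.subset_span (by simp)
    simp only [Submodule.span_le, Set.insert_subset_iff, Set.singleton_subset_iff,
      SetLike.mem_coe]
    exact ⟨Submodule.smul_mem _ _ hP, add_mem hQ (Submodule.smul_mem _ _ hR),
      Submodule.smul_mem _ _ (sub_mem hQ (Submodule.smul_mem _ _ hR))⟩
  · simp only [Submodule.span_le, Set.insert_subset_iff, Set.singleton_subset_iff,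
      SetLike.mem_coe, Submodule.mem_span_triple]
    refine ⟨⟨1 / t, 0, 0, ?_⟩, ⟨0, 1 / 2, 2 / t ^ 2, ?_⟩, ⟨0, 1 / (2 * t), -2 / t ^ 3, ?_⟩⟩ <;>
    · match_scalars <;> field_simp <;> norm_num
  · simp only [smul_lie, lie_add, lie_smul, h.lie_PQ, hPR]
    match_scalars <;> field_simp
  · simp only [smul_lie, lie_sub, lie_smul, h.lie_PQ, hPR]
    match_scalars <;> field_simp
  · simp only [add_lie, smul_lie, lie_sub, lie_smul, lie_self, h.lie_QR, hRQ]
    match_scalars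
    field_simp
    norm_num

end IsRotationTriple

/-- The brackets of the real span of `i T, X1 - X2, i (X1 + X2), i X3, X4 - X5, i (X4 + X5)`
in the complex Lie algebra `D.6_a`. -/
structure IsRealD6 (a : ℝ) (T U₁ U₂ Z V₁ V₂ : L) : Prop where
  lie_T_U₁ : ⁅T, U₁⁆ = U₂
  lie_T_U₂ : ⁅T, U₂⁆ = -U₁
  lie_T_Z : ⁅T, Z⁆ = 0
  lie_T_V₁ : ⁅T, V₁⁆ = V₂
  lie_T_V₂ : ⁅T, V₂⁆ = -V₁
  lie_U₁_U₂ : ⁅U₁, U₂⁆ = (6 * a) • T - (4 : ℝ) • Z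
  lie_U₁_Z : ⁅U₁, Z⁆ = (2 * a) • U₂ + (3 : ℝ) • V₂
  lie_U₁_V₁ : ⁅U₁, V₁⁆ = 0
  lie_U₁_V₂ : ⁅U₁, V₂⁆ = (12 : ℝ) • T - (2 * a) • Z
  lie_U₂_Z : ⁅U₂, Z⁆ = -((2 * a) • U₁ + (3 : ℝ) • V₁)
  lie_U₂_V₁ : ⁅U₂, V₁⁆ = (2 * a) • Z - (12 : ℝ) • T
  lie_U₂_V₂ : ⁅U₂, V₂⁆ = 0
  lie_Z_V₁ : ⁅Z, V₁⁆ = -((a ^ 2 + 3) • U₂)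
  lie_Z_V₂ : ⁅Z, V₂⁆ = (a ^ 2 + 3) • U₁
  lie_V₁_V₂ : ⁅V₁, V₂⁆ = (2 * a * (a ^ 2 - 1)) • T - (4 : ℝ) • Z

namespace IsRealD6

variable {a : ℝ} {T U₁ U₂ Z V₁ V₂ : L}

theorem lie_mem_span (h : IsRealD6 a T U₁ U₂ Z V₁ V₂) {x y : L}
    (hx : x ∈ Submodule.span ℝ {T, U₁, U₂, Z, V₁, V₂})
    (hy : y ∈ Submodule.span ℝ {T, U₁, U₂, Z, V₁, V₂}) :
    ⁅x, y⁆ ∈ Submodule.span ℝ {T, U₁, U₂, Z, V₁, V₂} := by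
  refine lie_mem_of_mem_span ?_ hx hy
  set N := Submodule.span ℝ {T, U₁, U₂, Z, V₁, V₂} with hN
  have hT : T ∈ N := Submodule.subset_span (by simp)
  have hU₁ : U₁ ∈ N := Submodule.subset_span (by simp)
  have hU₂ : U₂ ∈ N := Submodule.subset_span (by simp)
  have hZ : Z ∈ N := Submodule.subset_span (by simp)
  have hV₁ : V₁ ∈ N := Submodule.subset_span (by simp)
  have hV₂ : V₂ ∈ N := Submodule.subset_span (by simp)
  have hskew {x y : L} (h : ⁅y, x⁆ ∈ N) : ⁅x, y⁆ ∈ N := by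
    rw [← lie_skew]; exact N.neg_mem h
  have hTU₁ : ⁅T, U₁⁆ ∈ N := by rwa [h.lie_T_U₁]
  have hTU₂ : ⁅T, U₂⁆ ∈ N := by rw [h.lie_T_U₂]; exact N.neg_mem hU₁
  have hTZ : ⁅T, Z⁆ ∈ N := by rw [h.lie_T_Z]; exact N.zero_mem
  have hTV₁ : ⁅T, V₁⁆ ∈ N := by rwa [h.lie_T_V₁]
  have hTV₂ : ⁅T, V₂⁆ ∈ N := by rw [h.lie_T_V₂]; exact N.neg_mem hV₁
  have hU₁U₂ : ⁅U₁, U₂⁆ ∈ N := by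
    rw [h.lie_U₁_U₂]; exact sub_mem (N.smul_mem _ hT) (N.smul_mem _ hZ)
  have hU₁Z : ⁅U₁, Z⁆ ∈ N := by
    rw [h.lie_U₁_Z]; exact add_mem (N.smul_mem _ hU₂) (N.smul_mem _ hV₂)
  have hU₁V₁ : ⁅U₁, V₁⁆ ∈ N := by rw [h.lie_U₁_V₁]; exact N.zero_mem
  have hU₁V₂ : ⁅U₁, V₂⁆ ∈ N := by
    rw [h.lie_U₁_V₂]; exact sub_mem (N.smul_mem _ hT) (N.smul_mem _ hZ)
  have hU₂Z : ⁅U₂, Z⁆ ∈ N := by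
    rw [h.lie_U₂_Z]; exact N.neg_mem (add_mem (N.smul_mem _ hU₁) (N.smul_mem _ hV₁))
  have hU₂V₁ : ⁅U₂, V₁⁆ ∈ N := by
    rw [h.lie_U₂_V₁]; exact sub_mem (N.smul_mem _ hZ) (N.smul_mem _ hT)
  have hU₂V₂ : ⁅U₂, V₂⁆ ∈ N := by rw [h.lie_U₂_V₂]; exact N.zero_mem
  have hZV₁ : ⁅Z, V₁⁆ ∈ N := by rw [h.lie_Z_V₁]; exact N.neg_mem (N.smul_mem _ hU₂)
  have hZV₂ : ⁅Z, V₂⁆ ∈ N := by rw [h.lie_Z_V₂]; exact N.smul_mem _ hU₁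
  have hV₁V₂ : ⁅V₁, V₂⁆ ∈ N := by
    rw [h.lie_V₁_V₂]; exact sub_mem (N.smul_mem _ hT) (N.smul_mem _ hZ)
  simp only [Set.mem_insert_iff, Set.mem_singleton_iff, forall_eq_or_imp, forall_eq, lie_self,
    zero_mem, true_and, and_true]
  refine ⟨?_, ?_, ?_, ?_, ?_, ?_⟩ <;> refine ⟨?_, ?_, ?_, ?_, ?_⟩ <;>
    first | assumption | (apply hskew; assumption)

/-- The parameters `p`, `q` are the eigenvalues of `ad X₃` on the span of `X₁`, `X₄`. -/
theorem isRotationTriple (h : IsRealD6 a T U₁ U₂ Z V₁ V₂) {p q c : ℝ}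
    (hsum : p + q = -(2 * a)) (hprod : p * q = -(3 * (a ^ 2 + 3)))
    (hc : c = -2 * p ^ 2 + 6 * a * p - 18) :
    IsRotationTriple (c * (p - q)) ((-p) • U₁ + (3 : ℝ) • V₁) ((-p) • U₂ + (3 : ℝ) • V₂)
      (c • (Z - q • T)) := by
  have hV₁U₂ : ⁅V₁, U₂⁆ = (12 : ℝ) • T - (2 * a) • Z := by
    rw [← lie_skew, h.lie_U₂_V₁, neg_sub]
  have hZU₁ : ⁅Z, U₁⁆ = -((2 * a) • U₂ + (3 : ℝ) • V₂) := by rw [← lie_skew, h.lie_U₁_Z]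
  have hV₂Z : ⁅V₂, Z⁆ = -((a ^ 2 + 3) • U₁) := by rw [← lie_skew, h.lie_Z_V₂]
  have hU₂T : ⁅U₂, T⁆ = U₁ := by rw [← lie_skew, h.lie_T_U₂, neg_neg]
  have hV₂T : ⁅V₂, T⁆ = V₁ := by rw [← lie_skew, h.lie_T_V₂, neg_neg]
  obtain rfl : q = -(2 * a) - p := by linear_combination hsum
  subst hc
  constructor
  · simp only [add_lie, lie_add, smul_lie, lie_smul, h.lie_U₁_U₂, h.lie_U₁_V₂, hV₁U₂,
      h.lie_V₁_V₂]
    match_scalars <;> grind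
  · simp only [sub_lie, lie_add, smul_lie, lie_smul, hZU₁, h.lie_Z_V₁, h.lie_T_U₁, h.lie_T_V₁]
    match_scalars <;> grind
  · simp only [add_lie, lie_sub, smul_lie, lie_smul, h.lie_U₂_Z, hV₂Z, hU₂T, hV₂T]
    match_scalars <;> grind

theorem lie_eq_zero (h : IsRealD6 a T U₁ U₂ Z V₁ V₂) {p q c d : ℝ}
    (hsum : p + q = -(2 * a)) (hprod : p * q = -(3 * (a ^ 2 + 3))) {x y : L}
    (hx : x ∈ Submodule.span ℝ {(-p) • U₁ + (3 : ℝ) • V₁, (-p) • U₂ + (3 : ℝ) • V₂,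
      c • (Z - q • T)})
    (hy : y ∈ Submodule.span ℝ {(-q) • U₁ + (3 : ℝ) • V₁, (-q) • U₂ + (3 : ℝ) • V₂,
      d • (Z - p • T)}) : ⁅x, y⁆ = 0 := by
  have hV₁U₁ : ⁅V₁, U₁⁆ = 0 := by rw [← lie_skew, h.lie_U₁_V₁, neg_zero]
  have hV₂U₂ : ⁅V₂, U₂⁆ = 0 := by rw [← lie_skew, h.lie_U₂_V₂, neg_zero]
  have hU₂U₁ : ⁅U₂, U₁⁆ = -((6 * a) • T - (4 : ℝ) • Z) := by rw [← lie_skew, h.lie_U₁_U₂]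
  have hV₂V₁ : ⁅V₂, V₁⁆ = -((2 * a * (a ^ 2 - 1)) • T - (4 : ℝ) • Z) := by
    rw [← lie_skew, h.lie_V₁_V₂]
  have hV₁U₂ : ⁅V₁, U₂⁆ = (12 : ℝ) • T - (2 * a) • Z := by
    rw [← lie_skew, h.lie_U₂_V₁, neg_sub]
  have hV₂U₁ : ⁅V₂, U₁⁆ = (2 * a) • Z - (12 : ℝ) • T := by
    rw [← lie_skew, h.lie_U₁_V₂, neg_sub]
  have hZU₁ : ⁅Z, U₁⁆ = -((2 * a) • U₂ + (3 : ℝ) • V₂) := by rw [← lie_skew, h.lie_U₁_Z]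
  have hZU₂ : ⁅Z, U₂⁆ = (2 * a) • U₁ + (3 : ℝ) • V₁ := by
    rw [← lie_skew, h.lie_U₂_Z, neg_neg]
  have hV₁Z : ⁅V₁, Z⁆ = (a ^ 2 + 3) • U₂ := by rw [← lie_skew, h.lie_Z_V₁, neg_neg]
  have hV₂Z : ⁅V₂, Z⁆ = -((a ^ 2 + 3) • U₁) := by rw [← lie_skew, h.lie_Z_V₂]
  have hU₁T : ⁅U₁, T⁆ = -U₂ := by rw [← lie_skew, h.lie_T_U₁]
  have hV₁T : ⁅V₁, T⁆ = -V₂ := by rw [← lie_skew, h.lie_T_V₁]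
  have hU₂T : ⁅U₂, T⁆ = U₁ := by rw [← lie_skew, h.lie_T_U₂, neg_neg]
  have hV₂T : ⁅V₂, T⁆ = V₁ := by rw [← lie_skew, h.lie_T_V₂, neg_neg]
  have hZT : ⁅Z, T⁆ = 0 := by rw [← lie_skew, h.lie_T_Z, neg_zero]
  obtain rfl : q = -(2 * a) - p := by linear_combination hsum
  rw [← Submodule.mem_bot ℝ]
  refine lie_mem_of_mem_span ?_ hx hy
  simp only [Set.mem_insert_iff, Set.mem_singleton_iff, forall_eq_or_imp, forall_eq,
    Submodule.mem_bot]
  refine ⟨⟨?_, ?_, ?_⟩, ⟨?_, ?_, ?_⟩, ?_, ?_, ?_⟩ <;>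
  · simp only [add_lie, sub_lie, lie_add, lie_sub, smul_lie, lie_smul, lie_self, h.lie_U₁_U₂,
      h.lie_U₁_V₁, h.lie_U₁_V₂, h.lie_U₁_Z, h.lie_U₂_Z, h.lie_U₂_V₁, h.lie_U₂_V₂, h.lie_Z_V₁,
      h.lie_Z_V₂, h.lie_V₁_V₂, h.lie_T_U₁, h.lie_T_U₂, h.lie_T_Z, h.lie_T_V₁, h.lie_T_V₂,
      hV₁U₁, hV₂U₂, hU₂U₁, hV₂V₁, hV₁U₂, hV₂U₁, hZU₁, hZU₂, hV₁Z, hV₂Z, hU₁T, hV₁T, hU₂T,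
      hV₂T, hZT]
    match_scalars <;> grind

end IsRealD6

theorem span_rotationTriples {T U₁ U₂ Z V₁ V₂ : L} {p q c d : ℝ} (hpq : p ≠ q) (hc : c ≠ 0)
    (hd : d ≠ 0) :
    Submodule.span ℝ {(-p) • U₁ + (3 : ℝ) • V₁, (-p) • U₂ + (3 : ℝ) • V₂, c • (Z - q • T)} ⊔
      Submodule.span ℝ {(-q) • U₁ + (3 : ℝ) • V₁, (-q) • U₂ + (3 : ℝ) • V₂, d • (Z - p • T)} =
    Submodule.span ℝ {T, U₁, U₂, Z, V₁, V₂} := by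
  have hpq' : p - q ≠ 0 := sub_ne_zero.2 hpq
  apply le_antisymm
  · set N := Submodule.span ℝ {T, U₁, U₂, Z, V₁, V₂}
    have hT : T ∈ N := Submodule.subset_span (by simp)
    have hU₁ : U₁ ∈ N := Submodule.subset_span (by simp)
    have hU₂ : U₂ ∈ N := Submodule.subset_span (by simp)
    have hZ : Z ∈ N := Submodule.subset_span (by simp)
    have hV₁ : V₁ ∈ N := Submodule.subset_span (by simp)
    have hV₂ : V₂ ∈ N := Submodule.subset_span (by simp)
    have hP (r : ℝ) : (-r) • U₁ + (3 : ℝ) • V₁ ∈ N :=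
      add_mem (N.smul_mem _ hU₁) (N.smul_mem _ hV₁)
    have hQ (r : ℝ) : (-r) • U₂ + (3 : ℝ) • V₂ ∈ N :=
      add_mem (N.smul_mem _ hU₂) (N.smul_mem _ hV₂)
    have hR (r s : ℝ) : s • (Z - r • T) ∈ N := N.smul_mem _ (sub_mem hZ (N.smul_mem _ hT))
    simp only [sup_le_iff, Submodule.span_le, Set.insert_subset_iff, Set.singleton_subset_iff,
      SetLike.mem_coe]
    exact ⟨⟨hP p, hQ p, hR q c⟩, hP q, hQ q, hR p d⟩
  · rw [← Submodule.span_union]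
    simp only [Set.insert_union, Set.singleton_union]
    set N := Submodule.span ℝ {(-p) • U₁ + (3 : ℝ) • V₁, (-p) • U₂ + (3 : ℝ) • V₂,
      c • (Z - q • T), (-q) • U₁ + (3 : ℝ) • V₁, (-q) • U₂ + (3 : ℝ) • V₂, d • (Z - p • T)}
    have hP₁ : (-p) • U₁ + (3 : ℝ) • V₁ ∈ N := Submodule.subset_span (by simp)
    have hP₂ : (-q) • U₁ + (3 : ℝ) • V₁ ∈ N := Submodule.subset_span (by simp)
    have hQ₁ : (-p) • U₂ + (3 : ℝ) • V₂ ∈ N := Submodule.subset_span (by simp)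
    have hQ₂ : (-q) • U₂ + (3 : ℝ) • V₂ ∈ N := Submodule.subset_span (by simp)
    have hR₁ : Z - q • T ∈ N := (N.smul_mem_iff hc).1 (Submodule.subset_span (by simp))
    have hR₂ : Z - p • T ∈ N := (N.smul_mem_iff hd).1 (Submodule.subset_span (by simp))
    have hT : T ∈ N := (N.smul_mem_iff hpq').1 (by convert sub_mem hR₁ hR₂ using 1; module)
    have hU₁ : U₁ ∈ N := (N.smul_mem_iff hpq').1 (by convert sub_mem hP₂ hP₁ using 1; module)
    have hU₂ : U₂ ∈ N := (N.smul_mem_iff hpq').1 (by convert sub_mem hQ₂ hQ₁ using 1; module)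
    have hZ : Z ∈ N := by simpa using add_mem hR₁ (N.smul_mem q hT)
    have hV₁ : V₁ ∈ N := (N.smul_mem_iff (three_ne_zero' ℝ)).1 (by
      convert add_mem hP₁ (N.smul_mem p hU₁) using 1; module)
    have hV₂ : V₂ ∈ N := (N.smul_mem_iff (three_ne_zero' ℝ)).1 (by
      convert add_mem hQ₁ (N.smul_mem p hU₂) using 1; module)
    simp only [Submodule.span_le, Set.insert_subset_iff, Set.singleton_subset_iff,
      SetLike.mem_coe]
    exact ⟨hT, hU₁, hU₂, hZ, hV₁, hV₂⟩

namespace IsRealD6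

variable {a : ℝ} {T U₁ U₂ Z V₁ V₂ : L}

theorem exists_rotationTriples (h : IsRealD6 a T U₁ U₂ Z V₁ V₂) (ha : 0 < a) (ha' : a ≠ 2) :
    ∃ (k l : ℝ) (P Q R P' Q' R' : L), (0 < k ↔ 2 < a) ∧ k ≠ 0 ∧ 0 < l ∧
      IsRotationTriple k P Q R ∧ IsRotationTriple l P' Q' R' ∧
      (∀ x ∈ Submodule.span ℝ {P, Q, R}, ∀ y ∈ Submodule.span ℝ {P', Q', R'}, ⁅x, y⁆ = 0) ∧
      Submodule.span ℝ {P, Q, R} ⊔ Submodule.span ℝ {P', Q', R'} =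
        Submodule.span ℝ {T, U₁, U₂, Z, V₁, V₂} := by
  obtain ⟨s, hs, hs2⟩ : ∃ s : ℝ, 0 < s ∧ s ^ 2 = 4 * a ^ 2 + 9 :=
    ⟨√(4 * a ^ 2 + 9), by positivity, Real.sq_sqrt (by positivity)⟩
  have hsum : (-a + s) + (-a - s) = -(2 * a) := by ring
  have hprod : (-a + s) * (-a - s) = -(3 * (a ^ 2 + 3)) := by linear_combination -hs2
  have hk : (-2 * (-a + s) ^ 2 + 6 * a * (-a + s) - 18) * ((-a + s) - (-a - s)) =
      4 * s ^ 2 * (5 * a - 2 * s) := by grind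
  have hl : (-2 * (-a - s) ^ 2 + 6 * a * (-a - s) - 18) * ((-a - s) - (-a + s)) =
      4 * s ^ 2 * (5 * a + 2 * s) := by grind
  have hk0 : 4 * s ^ 2 * (5 * a - 2 * s) ≠ 0 := by
    have h1 : 5 * a - 2 * s ≠ 0 := fun h0 ↦ ha' (by
      have : 9 * (a - 2) * (a + 2) = 0 := by grind
      have : a + 2 ≠ 0 := by positivity
      grind)
    positivity
  have hl0 : 0 < 4 * s ^ 2 * (5 * a + 2 * s) := by positivity
  have hkpos : 0 < 4 * s ^ 2 * (5 * a - 2 * s) ↔ 2 < a := by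
    rw [mul_pos_iff_of_pos_left (by positivity)]
    constructor <;> intro <;> nlinarith
  refine ⟨_, _, _, _, _, _, _, _, ?_, ?_, ?_, h.isRotationTriple hsum hprod rfl,
    h.isRotationTriple (p := -a - s) (q := -a + s) (by rw [add_comm, hsum])
      (by rw [mul_comm, hprod]) rfl,
    fun x hx y hy ↦ h.lie_eq_zero hsum hprod hx hy, span_rotationTriples ?_ ?_ ?_⟩
  · rwa [hk]
  · rwa [hk]
  · rwa [hl]
  · linarith
  · exact left_ne_zero_of_mul (hk ▸ hk0)
  · exact left_ne_zero_of_mul (hl ▸ hl0.ne')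

end IsRealD6

end RealLieAlgebra

section ComplexLieAlgebra

open Complex

variable {F : Type*} [LieRing F] [LieAlgebra ℂ F] {T X1 X2 X3 X4 X5 : F}

theorem linearIndependent_real_span_D6
    (h : LinearIndependent ℂ ![T, X1, X2, X3, X4, X5]) :
    LinearIndependent ℝ
      ![I • T, X1 - X2, I • (X1 + X2), I • X3, X4 - X5, I • (X4 + X5)] := by
  rw [Fintype.linearIndependent_iff] at h ⊢
  intro g hg
  have key := h ![g 0 * I, g 1 + g 2 * I, -g 1 + g 2 * I, g 3 * I, g 4 + g 5 * I,
    -g 4 + g 5 * I] (by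
      rw [← hg]
      simp only [Fin.sum_univ_six, Matrix.cons_val, ← Complex.coe_smul]
      module)
  have h0 := key 0
  have h1 := key 1
  have h3 := key 3
  have h4 := key 4
  simp only [Matrix.cons_val, Complex.ext_iff, add_re, add_im, mul_re, mul_im, ofReal_re,
    ofReal_im, I_re, I_im, zero_re, zero_im, mul_zero, mul_one, sub_zero, add_zero,
    zero_add, true_and] at h0 h1 h3 h4
  intro i
  fin_cases i
  exacts [h0, h1.1, h1.2, h3, h4.1, h4.2]

end ComplexLieAlgebra


set_option maxHeartbeats 1000000

theorem D6_real_form_psi_tilde_neg_one (a : ℝ)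
    {F : Type*} [LieRing F] [LieAlgebra ℂ F]
    (T X1 X2 X3 X4 X5 : F)
    (hbindep : LinearIndependent ℂ ![T, X1, X2, X3, X4, X5])
    (hbspan : Submodule.span ℂ (Set.range ![T, X1, X2, X3, X4, X5]) = ⊤)
    (hb01 : ⁅T, X1⁆ = X1)
    (hb02 : ⁅T, X2⁆ = -X2)
    (hb03 : ⁅T, X3⁆ = 0)
    (hb04 : ⁅T, X4⁆ = X4)
    (hb05 : ⁅T, X5⁆ = -X5)
    (hb12 : ⁅X1, X2⁆ = (3*(a : ℂ)) • T + (-2 : ℂ) • X3)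
    (hb13 : ⁅X1, X3⁆ = (2*(a : ℂ)) • X1 + (3 : ℂ) • X4)
    (hb14 : ⁅X1, X4⁆ = 0)
    (hb15 : ⁅X1, X5⁆ = (6 : ℂ) • T + (-(a : ℂ)) • X3)
    (hb23 : ⁅X2, X3⁆ = (-(2*(a : ℂ))) • X2 + (-3 : ℂ) • X5)
    (hb24 : ⁅X2, X4⁆ = (-6 : ℂ) • T + ((a : ℂ)) • X3)
    (hb25 : ⁅X2, X5⁆ = 0)
    (hb34 : ⁅X3, X4⁆ = (-((a : ℂ)^2+3)) • X1)
    (hb35 : ⁅X3, X5⁆ = ((a : ℂ)^2+3) • X2)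
    (hb45 : ⁅X4, X5⁆ = ((a : ℂ)*((a : ℂ)^2-1)) • T + (-2 : ℂ) • X3)
    (H : Submodule ℝ F)
    (hH : H = Submodule.span ℝ
      ({Complex.I • T, X1 - X2, Complex.I • (X1 + X2),
        Complex.I • X3, X4 - X5, Complex.I • (X4 + X5)} : Set F)) :
    LinearIndependent ℝ ![Complex.I • T, X1 - X2, Complex.I • (X1 + X2), Complex.I • X3, X4 - X5, Complex.I • (X4 + X5)] ∧
    (∀ x ∈ H, ∀ y ∈ H, ⁅x, y⁆ ∈ H) ∧
    (2 < a → ∃ A1 B1 C1 A2 B2 C2 : F,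
      Submodule.span ℝ ({A1, B1, C1, A2, B2, C2} : Set F) = H ∧
      LinearIndependent ℝ ![A1, B1, C1, A2, B2, C2] ∧
      (⁅A1, B1⁆ = C1) ∧
      (⁅A1, C1⁆ = -B1) ∧
      (⁅A1, A2⁆ = 0) ∧
      (⁅A1, B2⁆ = 0) ∧
      (⁅A1, C2⁆ = 0) ∧
      (⁅B1, C1⁆ = A1) ∧
      (⁅B1, A2⁆ = 0) ∧
      (⁅B1, B2⁆ = 0) ∧
      (⁅B1, C2⁆ = 0) ∧
      (⁅C1, A2⁆ = 0) ∧
      (⁅C1, B2⁆ = 0) ∧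
      (⁅C1, C2⁆ = 0) ∧
      (⁅A2, B2⁆ = C2) ∧
      (⁅A2, C2⁆ = -B2) ∧
      (⁅B2, C2⁆ = A2)) ∧
    (0 < a → a < 2 → ∃ Hs Xs Ys As Bs Cs : F,
      Submodule.span ℝ ({Hs, Xs, Ys, As, Bs, Cs} : Set F) = H ∧
      LinearIndependent ℝ ![Hs, Xs, Ys, As, Bs, Cs] ∧
      (⁅Hs, Xs⁆ = (2 : ℝ) • Xs) ∧
      (⁅Hs, Ys⁆ = (-2 : ℝ) • Ys) ∧
      (⁅Hs, As⁆ = 0) ∧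
      (⁅Hs, Bs⁆ = 0) ∧
      (⁅Hs, Cs⁆ = 0) ∧
      (⁅Xs, Ys⁆ = Hs) ∧
      (⁅Xs, As⁆ = 0) ∧
      (⁅Xs, Bs⁆ = 0) ∧
      (⁅Xs, Cs⁆ = 0) ∧
      (⁅Ys, As⁆ = 0) ∧
      (⁅Ys, Bs⁆ = 0) ∧
      (⁅Ys, Cs⁆ = 0) ∧
      (⁅As, Bs⁆ = Cs) ∧
      (⁅As, Cs⁆ = -Bs) ∧
      (⁅Bs, Cs⁆ = As)) := by
  let := LieAlgebra.complexToReal F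
  have hD : IsRealD6 a (Complex.I • T) (X1 - X2) (Complex.I • (X1 + X2)) (Complex.I • X3)
      (X4 - X5) (Complex.I • (X4 + X5)) := by
    have hI : Complex.I ^ 2 = -1 := Complex.I_sq
    have hb21 := (lie_skew X2 X1).symm
    have hb54 := (lie_skew X5 X4).symm
    rw [hb12] at hb21
    rw [hb45] at hb54
    constructor <;>
    · simp only [add_lie, sub_lie, lie_add, lie_sub, smul_lie (R := ℂ), lie_smul (R := ℂ),
        lie_self, ← Complex.coe_smul, hb01, hb02, hb03, hb04, hb05, hb12, hb13, hb14, hb15,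
        hb23, hb24, hb25, hb34, hb35, hb45, hb21, hb54]
      push_cast
      match_scalars <;> grind
  have hli := linearIndependent_real_span_D6 hbindep
  have hli' {A B C D E G : F} (h : Submodule.span ℝ {A, B, C, D, E, G} = H) :
      LinearIndependent ℝ ![A, B, C, D, E, G] := by
    refine linearIndependent_of_span_range_eq hli ?_
    simp only [Matrix.range_cons, Matrix.range_empty, Set.union_empty, Set.singleton_union]
    rw [h, hH]
  have hspan (A B C D E G : F) : Submodule.span ℝ {A, B, C, D, E, G} =
      Submodule.span ℝ {A, B, C} ⊔ Submodule.span ℝ {D, E, G} := by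
    rw [← Submodule.span_union]
    simp only [Set.insert_union, Set.singleton_union]
  have hmem (A B C : F) : A ∈ Submodule.span ℝ {A, B, C} ∧
      B ∈ Submodule.span ℝ {A, B, C} ∧ C ∈ Submodule.span ℝ {A, B, C} :=
    ⟨Submodule.subset_span (by simp), Submodule.subset_span (by simp),
      Submodule.subset_span (by simp)⟩
  refine ⟨hli, ?_, ?_, ?_⟩
  · rw [hH]
    exact fun x hx y hy ↦ hD.lie_mem_span hx hy
  · intro ha
    obtain ⟨k, l, P, Q, R, P', Q', R', hk, -, hl, h, h', hcomm, hsup⟩ :=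
      hD.exists_rotationTriples (by linarith) ha.ne'
    obtain ⟨A, B, C, hABC, h1, h2, h3⟩ := h.exists_so3_basis (hk.2 ha)
    obtain ⟨A', B', C', hABC', h1', h2', h3'⟩ := h'.exists_so3_basis hl
    rw [← hABC, ← hABC'] at hcomm
    rw [← hABC, ← hABC', ← hspan, ← hH] at hsup
    obtain ⟨hA, hB, hC⟩ := hmem A B C
    obtain ⟨hA', hB', hC'⟩ := hmem A' B' C'
    exact ⟨A, B, C, A', B', C', hsup, hli' hsup, h1, h2, hcomm _ hA _ hA', hcomm _ hA _ hB',
      hcomm _ hA _ hC', h3, hcomm _ hB _ hA', hcomm _ hB _ hB', hcomm _ hB _ hC',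
      hcomm _ hC _ hA', hcomm _ hC _ hB', hcomm _ hC _ hC', h1', h2', h3'⟩
  · intro ha ha2
    obtain ⟨k, l, P, Q, R, P', Q', R', hk, hk0, hl, h, h', hcomm, hsup⟩ :=
      hD.exists_rotationTriples ha ha2.ne
    obtain ⟨A, B, C, hABC, h1, h2, h3⟩ :=
      h.exists_sl2_basis (lt_of_le_of_ne (not_lt.1 (hk.not.2 ha2.not_gt)) hk0)
    obtain ⟨A', B', C', hABC', h1', h2', h3'⟩ := h'.exists_so3_basis hl
    rw [← hABC, ← hABC'] at hcomm
    rw [← hABC, ← hABC', ← hspan, ← hH] at hsup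
    obtain ⟨hA, hB, hC⟩ := hmem A B C
    obtain ⟨hA', hB', hC'⟩ := hmem A' B' C'
    exact ⟨A, B, C, A', B', C', hsup, hli' hsup, h1, h2, hcomm _ hA _ hA', hcomm _ hA _ hB',
      hcomm _ hA _ hC', h3, hcomm _ hB _ hA', hcomm _ hB _ hB', hcomm _ hB _ hC',
      hcomm _ hC _ hA', hcomm _ hC _ hB', hcomm _ hC _ hC', h1', h2', h3'⟩
end

section
/- (Infinitesimal holonomy of the D.6_0 model.) In 𝔤, let 𝔥 := span{−Z1+2Z2, e01, f01, f21+e21, f10+e32, f11+e31, f31+e11, f32+e10}. Then 𝔥 is an 8-dimensional Lie subalgebra of 𝔤 isomorphic to sl(3,ℂ), and 𝔥 is the smallest subspace of 𝔤 that contains the three elements −Z1+2Z2, e01, f01 and is invariant under ad(x) for each of the six D.6_0 model elements −Z1+2Z2, f10+e32, f11+e31, f21+e21, f31+e11, f32+e10. -/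
section SpecialLinear

open LieAlgebra.SpecialLinear

attribute [local instance] LieRing.ofAssociativeRing

variable {n R L : Type*} [Fintype n] [DecidableEq n] [CommRing R] [LieRing L] [LieAlgebra R L]

/-- Elements `E i j` of a Lie algebra that satisfy the commutation relations of the matrix units
determine a homomorphism from the Lie algebra of matrices. -/
def Matrix.lieLift (E : Matrix n n L)
    (hE : ∀ i j k l, ⁅E i j, E k l⁆ = (if j = k then E i l else 0) - if l = i then E k j else 0) :
    Matrix n n R →ₗ⁅R⁆ L where
  toFun A := ∑ i, ∑ j, A i j • E i j
  map_add' A B := by simp [add_smul, Finset.sum_add_distrib]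
  map_smul' c A := by simp [mul_smul, Finset.smul_sum]
  map_lie' {A B} := by
    have mul_expand (X Y : Matrix n n R) : ∑ i, ∑ j, (X * Y) i j • E i j =
        ∑ i, ∑ j, ∑ l, (X i j * Y j l) • E i l := by
      refine Finset.sum_congr rfl fun i _ => ?_
      rw [Finset.sum_comm]
      simp [Matrix.mul_apply, Finset.sum_smul]
    have lie_expand : ⁅∑ i, ∑ j, A i j • E i j, ∑ k, ∑ l, B k l • E k l⁆ =
        ∑ i, ∑ j, ∑ k, ∑ l, (A i j * B k l) •
          ((if j = k then E i l else 0) - if l = i then E k j else 0) := by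
      simp only [sum_lie, smul_lie]
      simp only [lie_sum, lie_smul, hE, Finset.smul_sum, smul_smul]
    simp only [LieRing.of_associative_ring_bracket, Matrix.sub_apply, sub_smul,
      Finset.sum_sub_distrib, mul_expand, lie_expand, smul_sub, smul_ite, smul_zero]
    congr 1
    · simp [Finset.sum_ite_irrel]
    · simp only [Finset.sum_ite_eq', Finset.mem_univ, if_true, mul_comm (B _ _)]
      have reorder (F : n → n → n → L) :
          ∑ i, ∑ j, ∑ k, F i j k = ∑ k, ∑ i, ∑ j, F i j k := by
        rw [Finset.sum_comm (f := fun k i => ∑ j, F i j k)]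
        exact Finset.sum_congr rfl fun i _ => Finset.sum_comm
      exact (reorder fun i j k => (A i j * B k i) • E k j).symm

/-- The restriction of `Matrix.lieLift` to trace-free matrices. -/
def LieAlgebra.SpecialLinear.lift (E : Matrix n n L)
    (hE : ∀ i j k l, ⁅E i j, E k l⁆ = (if j = k then E i l else 0) - if l = i then E k j else 0) :
    sl n R →ₗ⁅R⁆ L :=
  (Matrix.lieLift E hE).comp (sl n R).incl

theorem LieAlgebra.SpecialLinear.lift_apply (E : Matrix n n L)
    (hE : ∀ i j k l, ⁅E i j, E k l⁆ = (if j = k then E i l else 0) - if l = i then E k j else 0)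
    (A : sl n R) : lift E hE A = ∑ i, ∑ j, A.val i j • E i j :=
  rfl

theorem LieAlgebra.SpecialLinear.lift_single (E : Matrix n n L)
    (hE : ∀ i j k l, ⁅E i j, E k l⁆ = (if j = k then E i l else 0) - if l = i then E k j else 0)
    {i j : n} (hij : i ≠ j) : lift E hE (single i j hij (1 : R)) = E i j := by
  simp [lift_apply, Matrix.single_apply, ite_and]

theorem LieAlgebra.SpecialLinear.finrank_sl_add_one (n K : Type*) [Fintype n] [DecidableEq n]
    [Nonempty n] [Field K] :
    Module.finrank K (sl n K) + 1 = Fintype.card n * Fintype.card n := by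
  have h := (Matrix.traceLinearMap n K K).finrank_range_add_finrank_ker
  have hr : LinearMap.range (Matrix.traceLinearMap n K K) = ⊤ :=
    LinearMap.range_eq_top.2 fun c =>
      ⟨Matrix.single (Classical.arbitrary n) (Classical.arbitrary n) c, by simp⟩
  rw [hr, finrank_top, Module.finrank_self, Module.finrank_matrix, Module.finrank_self,
    mul_one, add_comm] at h
  exact h

end SpecialLinear

set_option maxHeartbeats 1000000

theorem D60_holonomy_sl3
    {g : Type*} [LieRing g] [LieAlgebra ℂ g]
    (Z1 Z2 e01 e10 e11 e21 e31 e32 f01 f10 f11 f21 f31 f32 : g)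
    (hindep : LinearIndependent ℂ ![Z1, Z2, e01, e10, e11, e21, e31, e32, f01, f10, f11, f21, f31, f32])
    (hspan : Submodule.span ℂ (Set.range ![Z1, Z2, e01, e10, e11, e21, e31, e32, f01, f10, f11, f21, f31, f32]) = ⊤)
    (hZ1Z2 : ⁅Z1, Z2⁆ = 0)
    (hZ1e01 : ⁅Z1, e01⁆ = 0)
    (hZ1e10 : ⁅Z1, e10⁆ = e10)
    (hZ1e11 : ⁅Z1, e11⁆ = e11)
    (hZ1e21 : ⁅Z1, e21⁆ = (2 : ℂ) • e21)
    (hZ1e31 : ⁅Z1, e31⁆ = (3 : ℂ) • e31)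
    (hZ1e32 : ⁅Z1, e32⁆ = (3 : ℂ) • e32)
    (hZ1f01 : ⁅Z1, f01⁆ = 0)
    (hZ1f10 : ⁅Z1, f10⁆ = -f10)
    (hZ1f11 : ⁅Z1, f11⁆ = -f11)
    (hZ1f21 : ⁅Z1, f21⁆ = (-2 : ℂ) • f21)
    (hZ1f31 : ⁅Z1, f31⁆ = (-3 : ℂ) • f31)
    (hZ1f32 : ⁅Z1, f32⁆ = (-3 : ℂ) • f32)
    (hZ2e01 : ⁅Z2, e01⁆ = e01)
    (hZ2e10 : ⁅Z2, e10⁆ = 0)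
    (hZ2e11 : ⁅Z2, e11⁆ = e11)
    (hZ2e21 : ⁅Z2, e21⁆ = e21)
    (hZ2e31 : ⁅Z2, e31⁆ = e31)
    (hZ2e32 : ⁅Z2, e32⁆ = (2 : ℂ) • e32)
    (hZ2f01 : ⁅Z2, f01⁆ = -f01)
    (hZ2f10 : ⁅Z2, f10⁆ = 0)
    (hZ2f11 : ⁅Z2, f11⁆ = -f11)
    (hZ2f21 : ⁅Z2, f21⁆ = -f21)
    (hZ2f31 : ⁅Z2, f31⁆ = -f31)
    (hZ2f32 : ⁅Z2, f32⁆ = (-2 : ℂ) • f32)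
    (he01e10 : ⁅e01, e10⁆ = -e11)
    (he01e11 : ⁅e01, e11⁆ = 0)
    (he01e21 : ⁅e01, e21⁆ = 0)
    (he01e31 : ⁅e01, e31⁆ = e32)
    (he01e32 : ⁅e01, e32⁆ = 0)
    (he01f01 : ⁅e01, f01⁆ = -Z1 + (2 : ℂ) • Z2)
    (he01f10 : ⁅e01, f10⁆ = 0)
    (he01f11 : ⁅e01, f11⁆ = f10)
    (he01f21 : ⁅e01, f21⁆ = 0)
    (he01f31 : ⁅e01, f31⁆ = 0)
    (he01f32 : ⁅e01, f32⁆ = -f31)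
    (he10e11 : ⁅e10, e11⁆ = (2 : ℂ) • e21)
    (he10e21 : ⁅e10, e21⁆ = (-3 : ℂ) • e31)
    (he10e31 : ⁅e10, e31⁆ = 0)
    (he10e32 : ⁅e10, e32⁆ = 0)
    (he10f01 : ⁅e10, f01⁆ = 0)
    (he10f10 : ⁅e10, f10⁆ = (2 : ℂ) • Z1 + (-3 : ℂ) • Z2)
    (he10f11 : ⁅e10, f11⁆ = (-3 : ℂ) • f01)
    (he10f21 : ⁅e10, f21⁆ = (-2 : ℂ) • f11)
    (he10f31 : ⁅e10, f31⁆ = f21)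
    (he10f32 : ⁅e10, f32⁆ = 0)
    (he11e21 : ⁅e11, e21⁆ = (3 : ℂ) • e32)
    (he11e31 : ⁅e11, e31⁆ = 0)
    (he11e32 : ⁅e11, e32⁆ = 0)
    (he11f01 : ⁅e11, f01⁆ = e10)
    (he11f10 : ⁅e11, f10⁆ = (-3 : ℂ) • e01)
    (he11f11 : ⁅e11, f11⁆ = -Z1 + (3 : ℂ) • Z2)
    (he11f21 : ⁅e11, f21⁆ = (2 : ℂ) • f10)
    (he11f31 : ⁅e11, f31⁆ = 0)
    (he11f32 : ⁅e11, f32⁆ = -f21)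
    (he21e31 : ⁅e21, e31⁆ = 0)
    (he21e32 : ⁅e21, e32⁆ = 0)
    (he21f01 : ⁅e21, f01⁆ = 0)
    (he21f10 : ⁅e21, f10⁆ = (-2 : ℂ) • e11)
    (he21f11 : ⁅e21, f11⁆ = (2 : ℂ) • e10)
    (he21f21 : ⁅e21, f21⁆ = Z1)
    (he21f31 : ⁅e21, f31⁆ = -f10)
    (he21f32 : ⁅e21, f32⁆ = f11)
    (he31e32 : ⁅e31, e32⁆ = 0)
    (he31f01 : ⁅e31, f01⁆ = 0)
    (he31f10 : ⁅e31, f10⁆ = e21)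
    (he31f11 : ⁅e31, f11⁆ = 0)
    (he31f21 : ⁅e31, f21⁆ = -e10)
    (he31f31 : ⁅e31, f31⁆ = Z1 + -Z2)
    (he31f32 : ⁅e31, f32⁆ = f01)
    (he32f01 : ⁅e32, f01⁆ = -e31)
    (he32f10 : ⁅e32, f10⁆ = 0)
    (he32f11 : ⁅e32, f11⁆ = -e21)
    (he32f21 : ⁅e32, f21⁆ = e11)
    (he32f31 : ⁅e32, f31⁆ = e01)
    (he32f32 : ⁅e32, f32⁆ = Z2)
    (hf01f10 : ⁅f01, f10⁆ = f11)
    (hf01f11 : ⁅f01, f11⁆ = 0)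
    (hf01f21 : ⁅f01, f21⁆ = 0)
    (hf01f31 : ⁅f01, f31⁆ = -f32)
    (hf01f32 : ⁅f01, f32⁆ = 0)
    (hf10f11 : ⁅f10, f11⁆ = (-2 : ℂ) • f21)
    (hf10f21 : ⁅f10, f21⁆ = (3 : ℂ) • f31)
    (hf10f31 : ⁅f10, f31⁆ = 0)
    (hf10f32 : ⁅f10, f32⁆ = 0)
    (hf11f21 : ⁅f11, f21⁆ = (-3 : ℂ) • f32)
    (hf11f31 : ⁅f11, f31⁆ = 0)
    (hf11f32 : ⁅f11, f32⁆ = 0)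
    (hf21f31 : ⁅f21, f31⁆ = 0)
    (hf21f32 : ⁅f21, f32⁆ = 0)
    (hf31f32 : ⁅f31, f32⁆ = 0)
    (H : Submodule ℂ g)
    (hH : H = Submodule.span ℂ
      ({-Z1 + (2 : ℂ) • Z2, e01, f01, f21 + e21, f10 + e32, f11 + e31,
        f31 + e11, f32 + e10} : Set g)) :
    (∃ S : LieSubalgebra ℂ g, (S : Submodule ℂ g) = H ∧ Module.finrank ℂ S = 8 ∧
      Nonempty (S ≃ₗ⁅ℂ⁆ LieAlgebra.SpecialLinear.sl (Fin 3) ℂ)) ∧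
    ((-Z1 + (2 : ℂ) • Z2 ∈ H ∧ e01 ∈ H ∧ f01 ∈ H) ∧
      (∀ y ∈ H, ⁅-Z1 + (2 : ℂ) • Z2, y⁆ ∈ H ∧ ⁅f10 + e32, y⁆ ∈ H ∧
        ⁅f11 + e31, y⁆ ∈ H ∧ ⁅f21 + e21, y⁆ ∈ H ∧ ⁅f31 + e11, y⁆ ∈ H ∧
        ⁅f32 + e10, y⁆ ∈ H) ∧
      (∀ W : Submodule ℂ g,
        (-Z1 + (2 : ℂ) • Z2 ∈ W ∧ e01 ∈ W ∧ f01 ∈ W) →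
        (∀ y ∈ W, ⁅-Z1 + (2 : ℂ) • Z2, y⁆ ∈ W ∧ ⁅f10 + e32, y⁆ ∈ W ∧
          ⁅f11 + e31, y⁆ ∈ W ∧ ⁅f21 + e21, y⁆ ∈ W ∧ ⁅f31 + e11, y⁆ ∈ W ∧
          ⁅f32 + e10, y⁆ ∈ W) →
        H ≤ W)) := by
  set h := -Z1 + (2 : ℂ) • Z2 with hh
  have skew {x y z : g} (hxy : ⁅x, y⁆ = z) : ⁅y, x⁆ = -z := by rw [← lie_skew, hxy]
  let E : Matrix (Fin 3) (Fin 3) g :=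
    !![(1 / 2 : ℂ) • h + (1 / 6 : ℂ) • (f21 + e21), e01, (f10 + e32) - (f31 + e11);
       f01, -(1 / 2 : ℂ) • h + (1 / 6 : ℂ) • (f21 + e21), (f11 + e31) + (f32 + e10);
       (1 / 8 : ℂ) • ((f32 + e10) - (f11 + e31)), (1 / 8 : ℂ) • ((f10 + e32) + (f31 + e11)),
         -(1 / 3 : ℂ) • (f21 + e21)]
  have hE (i j k l : Fin 3) : ⁅E i j, E k l⁆ =
      (if j = k then E i l else 0) - if l = i then E k j else 0 := by
    fin_cases i <;> fin_cases j <;> fin_cases k <;> fin_cases l <;>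
    · simp [E, hh, sub_eq_add_neg,
        hZ1Z2, hZ1e01, hZ1e10, hZ1e11, hZ1e21, hZ1e31, hZ1e32, hZ1f01, hZ1f10, hZ1f11, hZ1f21,
        hZ1f31, hZ1f32, hZ2e01, hZ2e10, hZ2e11, hZ2e21, hZ2e31, hZ2e32, hZ2f01, hZ2f10, hZ2f11,
        hZ2f21, hZ2f31, hZ2f32, he01e10, he01e11, he01e21, he01e31, he01e32, he01f01, he01f10,
        he01f11, he01f21, he01f31, he01f32, he10e11, he10e21, he10e31, he10e32, he10f01, he10f10,
        he10f11, he10f21, he10f31, he10f32, he11e21, he11e31, he11e32, he11f01, he11f10, he11f11,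
        he11f21, he11f31, he11f32, he21e31, he21e32, he21f01, he21f10, he21f11, he21f21, he21f31,
        he21f32, he31e32, he31f01, he31f10, he31f11, he31f21, he31f31, he31f32, he32f01, he32f10,
        he32f11, he32f21, he32f31, he32f32, hf01f10, hf01f11, hf01f21, hf01f31, hf01f32, hf10f11,
        hf10f21, hf10f31, hf10f32, hf11f21, hf11f31, hf11f32, hf21f31, hf21f32, hf31f32,
        skew hZ1Z2, skew hZ1e01, skew hZ1e10, skew hZ1e11, skew hZ1e21, skew hZ1e31, skew hZ1e32,
        skew hZ1f01, skew hZ1f10, skew hZ1f11, skew hZ1f21, skew hZ1f31, skew hZ1f32,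
        skew hZ2e01, skew hZ2e10, skew hZ2e11, skew hZ2e21, skew hZ2e31, skew hZ2e32,
        skew hZ2f01, skew hZ2f10, skew hZ2f11, skew hZ2f21, skew hZ2f31, skew hZ2f32,
        skew he01e10, skew he01e11, skew he01e21, skew he01e31, skew he01e32, skew he01f01,
        skew he01f10, skew he01f11, skew he01f21, skew he01f31, skew he01f32, skew he10e11,
        skew he10e21, skew he10e31, skew he10e32, skew he10f01, skew he10f10, skew he10f11,
        skew he10f21, skew he10f31, skew he10f32, skew he11e21, skew he11e31, skew he11e32,
        skew he11f01, skew he11f10, skew he11f11, skew he11f21, skew he11f31, skew he11f32,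
        skew he21e31, skew he21e32, skew he21f01, skew he21f10, skew he21f11, skew he21f21,
        skew he21f31, skew he21f32, skew he31e32, skew he31f01, skew he31f10, skew he31f11,
        skew he31f21, skew he31f31, skew he31f32, skew he32f01, skew he32f10, skew he32f11,
        skew he32f21, skew he32f31, skew he32f32, skew hf01f10, skew hf01f11, skew hf01f21,
        skew hf01f31, skew hf01f32, skew hf10f11, skew hf10f21, skew hf10f31, skew hf10f32,
        skew hf11f21, skew hf11f31, skew hf11f32, skew hf21f31, skew hf21f32, skew hf31f32]
      try module
  have h_lie : ⁅e01, f01⁆ = h := he01f01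
  have b5_lie : ⁅f10 + e32, f01⁆ = -(f11 + e31) := by
    simp only [add_lie, skew hf01f10, he32f01]; module
  have b4_lie : ⁅f11 + e31, e01⁆ = -(f10 + e32) := by
    simp only [add_lie, skew he01f11, skew he01e31]; module
  have b3_lie : ⁅f10 + e32, f11 + e31⁆ = (-2 : ℂ) • (f21 + e21) := by
    simp only [add_lie, lie_add, hf10f11, skew he31f10, he32f11, skew he31e32]; module
  have b7_lie : ⁅f31 + e11, f01⁆ = f32 + e10 := by
    simp only [add_lie, skew hf01f31, he11f01]; module
  have b6_lie : ⁅f32 + e10, e01⁆ = f31 + e11 := by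
    simp only [add_lie, skew he01f32, skew he01e10]; module
  have memH {x : g} (hx : x ∈ ({h, e01, f01, f21 + e21, f10 + e32, f11 + e31,
      f31 + e11, f32 + e10} : Set g)) : x ∈ H := hH ▸ Submodule.subset_span hx
  let φ := LieAlgebra.SpecialLinear.lift (R := ℂ) E hE
  have hmem {i j : Fin 3} (hij : i ≠ j) : E i j ∈ φ.range :=
    ⟨_, LieAlgebra.SpecialLinear.lift_single E hE hij⟩
  have mem_e01 : e01 ∈ φ.range := hmem (i := 0) (j := 1) (by decide)
  have mem_f01 : f01 ∈ φ.range := hmem (i := 1) (j := 0) (by decide)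
  have mem_h : h ∈ φ.range := h_lie ▸ φ.range.lie_mem mem_e01 mem_f01
  have mem_E02 : (f10 + e32) - (f31 + e11) ∈ φ.range := hmem (i := 0) (j := 2) (by decide)
  have mem_E21 : (1 / 8 : ℂ) • ((f10 + e32) + (f31 + e11)) ∈ φ.range :=
    hmem (i := 2) (j := 1) (by decide)
  have mem_b4 : f10 + e32 ∈ φ.range := by
    convert add_mem (φ.range.smul_mem (1 / 2) mem_E02) (φ.range.smul_mem 4 mem_E21) using 1
    module
  have mem_b6 : f31 + e11 ∈ φ.range := by
    convert sub_mem mem_b4 mem_E02 using 1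
    module
  have mem_b5 : f11 + e31 ∈ φ.range := by
    rw [← neg_mem_iff, ← b5_lie]
    exact φ.range.lie_mem mem_b4 mem_f01
  have mem_b7 : f32 + e10 ∈ φ.range := b7_lie ▸ φ.range.lie_mem mem_b6 mem_f01
  have mem_b3 : f21 + e21 ∈ φ.range := by
    convert φ.range.smul_mem (-1 / 2) (φ.range.lie_mem mem_b4 mem_b5) using 1
    rw [b3_lie]
    module
  have hrange : (φ.range : Submodule ℂ g) = H := by
    apply le_antisymm
    · rintro _ ⟨A, rfl⟩
      change φ A ∈ H
      rw [LieAlgebra.SpecialLinear.lift_apply]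
      have hE_mem (i j : Fin 3) : E i j ∈ H := by
        have m0 : h ∈ H := memH (by simp)
        have m1 : e01 ∈ H := memH (by simp)
        have m2 : f01 ∈ H := memH (by simp)
        have m3 : f21 + e21 ∈ H := memH (by simp)
        have m4 : f10 + e32 ∈ H := memH (by simp)
        have m5 : f11 + e31 ∈ H := memH (by simp)
        have m6 : f31 + e11 ∈ H := memH (by simp)
        have m7 : f32 + e10 ∈ H := memH (by simp)
        fin_cases i <;> fin_cases j
        exacts [add_mem (H.smul_mem _ m0) (H.smul_mem _ m3), m1, sub_mem m4 m6, m2,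
          add_mem (H.smul_mem _ m0) (H.smul_mem _ m3), add_mem m5 m7,
          H.smul_mem _ (sub_mem m7 m5), H.smul_mem _ (add_mem m4 m6), H.smul_mem _ m3]
      exact sum_mem fun i _ => sum_mem fun j _ => H.smul_mem _ (hE_mem i j)
    · rw [hH, Submodule.span_le]
      rintro x (rfl | rfl | rfl | rfl | rfl | rfl | rfl | rfl)
      exacts [mem_h, mem_e01, mem_f01, mem_b3, mem_b4, mem_b5, mem_b6, mem_b7]
  have hfinrank : Module.finrank ℂ φ.range = 8 := by
    have hli : LinearIndependent ℂ ![h, e01, f01, f21 + e21, f10 + e32, f11 + e31,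
        f31 + e11, f32 + e10] := by
      rw [Fintype.linearIndependent_iff] at hindep ⊢
      intro c hc
      have hc' := hindep ![-c 0, 2 * c 0, c 1, c 7, c 6, c 3, c 5, c 4, c 2, c 4, c 5, c 3, c 6,
        c 7] (by
          rw [← hc]
          simp [Fin.sum_univ_succ, hh]
          module)
      intro i
      fin_cases i
      exacts [by simpa using hc' 0, hc' 2, hc' 8, hc' 5, hc' 7, hc' 6, hc' 4, hc' 3]
    have hset : ({h, e01, f01, f21 + e21, f10 + e32, f11 + e31, f31 + e11, f32 + e10} : Set g) =
        Set.range ![h, e01, f01, f21 + e21, f10 + e32, f11 + e31, f31 + e11, f32 + e10] := by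
      simp only [Matrix.range_cons, Matrix.range_empty, Set.union_empty, Set.singleton_union]
    change Module.finrank ℂ (φ.range : Submodule ℂ g) = 8
    rw [hrange, hH, hset, finrank_span_eq_card hli, Fintype.card_fin]
  have hsl : Module.finrank ℂ (LieAlgebra.SpecialLinear.sl (Fin 3) ℂ) = 8 := by
    have := LieAlgebra.SpecialLinear.finrank_sl_add_one (Fin 3) ℂ
    simpa using this
  have hinj : Function.Injective φ := by
    have := Module.finite_of_finrank_pos (R := ℂ)
      (M := LieAlgebra.SpecialLinear.sl (Fin 3) ℂ) (by omega)
    have hker := φ.toLinearMap.finrank_range_add_finrank_ker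
    have hr : Module.finrank ℂ (LinearMap.range φ.toLinearMap) = 8 := hfinrank
    have hz : Module.finrank ℂ (LinearMap.ker φ.toLinearMap) = 0 := by omega
    exact LinearMap.ker_eq_bot.1 (Submodule.finrank_eq_zero.1 hz)
  refine ⟨⟨φ.range, hrange, hfinrank, ⟨(LieEquiv.ofInjective φ hinj).symm⟩⟩,
    ⟨memH (by simp), memH (by simp), memH (by simp)⟩, fun y hy => ?_, ?_⟩
  · rw [← hrange] at hy ⊢
    exact ⟨φ.range.lie_mem mem_h hy, φ.range.lie_mem mem_b4 hy, φ.range.lie_mem mem_b5 hy,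
      φ.range.lie_mem mem_b3 hy, φ.range.lie_mem mem_b6 hy, φ.range.lie_mem mem_b7 hy⟩
  · rintro W ⟨w0, w1, w2⟩ hW
    have w5 : f11 + e31 ∈ W := by
      rw [← neg_mem_iff, ← b5_lie]
      exact (hW _ w2).2.1
    have w4 : f10 + e32 ∈ W := by
      rw [← neg_mem_iff, ← b4_lie]
      exact (hW _ w1).2.2.1
    have w3 : f21 + e21 ∈ W := by
      convert W.smul_mem (-1 / 2) (hW _ w5).2.1 using 1
      rw [b3_lie]
      module
    have w6 : f31 + e11 ∈ W := b6_lie ▸ (hW _ w1).2.2.2.2.2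
    have w7 : f32 + e10 ∈ W := b7_lie ▸ (hW _ w2).2.2.2.2.1
    rw [hH, Submodule.span_le]
    rintro x (rfl | rfl | rfl | rfl | rfl | rfl | rfl | rfl)
    exacts [w0, w1, w2, w3, w4, w5, w6, w7]
end

section
/- (The curvature module for (2,3,5)-geometries.) In 𝔤, let 𝔭 := span{Z1, Z2, e01, f01, e10, e11, e21, e31, e32} and 𝔭₊ := span{e10, e11, e21, e31, e32}; note that [𝔭, 𝔭₊] ⊆ 𝔭₊, so W := Λ²𝔭₊ ⊗ 𝔤 carries the 𝔭-action z·(X∧Y⊗v) = [z,X]∧Y⊗v + X∧[z,Y]⊗v + X∧Y⊗[z,v]. Let ∂* : W → 𝔭₊ ⊗ 𝔤 be the linear map determined by ∂*(X∧Y⊗v) = −Y⊗[X,v] + X⊗[Y,v] − [X,Y]⊗v, and let E be the smallest 𝔭-invariant subspace of W containing φ₀ := e10∧e31⊗f01. Then: (i) dim E = 24; (ii) E ⊆ Λ²𝔭₊ ⊗ 𝔭; (iii) ∂*(E) = 0. -/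
set_option maxHeartbeats 1000000

open TensorProduct

/-- The elements of a Lie algebra that map a given subspace of a representation to itself. -/
def Submodule.lieStabilizer {R L M : Type*} [CommRing R] [LieRing L] [LieAlgebra R L]
    [AddCommGroup M] [Module R M] [LieRingModule L M] [LieModule R L M] (N : Submodule R M) :
    LieSubalgebra R L where
  carrier := {x | ∀ m ∈ N, ⁅x, m⁆ ∈ N}
  add_mem' hx hy m hm := by
    rw [add_lie]
    exact N.add_mem (hx m hm) (hy m hm)
  zero_mem' m _ := by simp
  smul_mem' c x hx m hm := by
    rw [smul_lie]
    exact N.smul_mem c (hx m hm)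
  lie_mem' {x y} hx hy m hm := by
    rw [lie_lie]
    exact N.sub_mem (hx _ (hy m hm)) (hy _ (hx m hm))

/-- A frame `Z1, Z2, e01, f01, e10, e11, e21, e31, e32` of the parabolic subalgebra of `Lie(G2)`
attached to (2,3,5)-distributions, with the brackets of its generators `Z1, Z2, e01, f01, e10`. -/
structure IsParabolicFrame {g : Type*} [LieRing g] [LieAlgebra ℂ g] (x : Fin 9 → g) : Prop where
  lie_Z1 : ∀ j, ⁅x 0, x j⁆ = (![0, 0, 0, 0, 1, 1, 2, 3, 3] j : ℂ) • x j
  lie_Z2 : ∀ j, ⁅x 1, x j⁆ = (![0, 0, 1, -1, 0, 1, 1, 1, 2] j : ℂ) • x j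
  lie_e01 : ∀ j, ⁅x 2, x j⁆ =
    ![0, -x 2, 0, -x 0 + (2 : ℂ) • x 1, -x 5, 0, 0, x 8, 0] j
  lie_f01 : ∀ j, ⁅x 3, x j⁆ =
    ![0, x 3, x 0 - (2 : ℂ) • x 1, 0, 0, -x 4, 0, 0, x 7] j
  lie_e10 : ∀ j, ⁅x 4, x j⁆ =
    ![-x 4, 0, x 5, 0, 0, (2 : ℂ) • x 6, (-3 : ℂ) • x 7, 0, 0] j

/-- The element `(x ∧ y) ⊗ v` of `Λ²g ⊗ g`, realized by antisymmetric tensors. -/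
noncomputable def wedgeTmul (g : Type*) [AddCommGroup g] [Module ℂ g] :
    g →ₗ[ℂ] g →ₗ[ℂ] g →ₗ[ℂ] (g ⊗[ℂ] g) ⊗[ℂ] g :=
  (TensorProduct.mk ℂ g g - (TensorProduct.mk ℂ g g).flip).compr₂ (TensorProduct.mk ℂ (g ⊗[ℂ] g) g)

/-- Coordinates of a basis of the curvature module: `(n, i, j, k)` stands for
`n • (x i ∧ x j) ⊗ x k`. The rows are grouped into strings for the action of `e01`, starting in
rows `0, 5, 9, 12, 16, 18, 21, 22`. -/
def curvatureTerms : Fin 24 → List (ℤ × Fin 9 × Fin 9 × Fin 9) := ![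
  [(1, 4, 7, 3)],
  [(-1, 4, 7, 0), (2, 4, 7, 1), (1, 4, 8, 3), (-1, 5, 7, 3)],
  [(-1, 4, 7, 2), (-1, 4, 8, 0), (2, 4, 8, 1), (1, 5, 7, 0), (-2, 5, 7, 1), (-1, 5, 8, 3)],
  [(-1, 4, 8, 2), (1, 5, 7, 2), (1, 5, 8, 0), (-2, 5, 8, 1)],
  [(1, 5, 8, 2)],
  [(1, 4, 7, 4), (-2, 6, 7, 3)],
  [(-1, 4, 7, 5), (1, 4, 8, 4), (-1, 5, 7, 4), (2, 6, 7, 0), (-4, 6, 7, 1), (-2, 6, 8, 3)],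
  [(-1, 4, 8, 5), (1, 5, 7, 5), (-1, 5, 8, 4), (2, 6, 7, 2), (2, 6, 8, 0), (-4, 6, 8, 1)],
  [(1, 5, 8, 5), (2, 6, 8, 2)],
  [(1, 4, 7, 6), (2, 6, 7, 4), (-3, 7, 8, 3)],
  [(1, 4, 8, 6), (-1, 5, 7, 6), (-2, 6, 7, 5), (2, 6, 8, 4), (3, 7, 8, 0), (-6, 7, 8, 1)],
  [(-1, 5, 8, 6), (-2, 6, 8, 5), (3, 7, 8, 2)],
  [(1, 4, 7, 7)],
  [(1, 4, 7, 8), (1, 4, 8, 7), (-1, 5, 7, 7)],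
  [(1, 4, 8, 8), (-1, 5, 7, 8), (-1, 5, 8, 7)],
  [(-1, 5, 8, 8)],
  [(2, 4, 7, 8), (-1, 4, 8, 7), (1, 5, 7, 7), (-6, 6, 7, 6), (-9, 7, 8, 4)],
  [(1, 4, 8, 8), (-1, 5, 7, 8), (2, 5, 8, 7), (-6, 6, 8, 6), (9, 7, 8, 5)],
  [(1, 6, 7, 7)],
  [(1, 6, 7, 8), (1, 6, 8, 7)],
  [(1, 6, 8, 8)],
  [(1, 6, 7, 8), (-1, 6, 8, 7), (-3, 7, 8, 6)],
  [(1, 7, 8, 7)],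
  [(1, 7, 8, 8)]]

/-- The monomial of the basis vector of the curvature module used to detect it. -/
def curvaturePivot : Fin 24 → Fin 9 × Fin 9 × Fin 9 := ![
  (4, 7, 3), (5, 7, 3), (5, 8, 3), (5, 8, 0), (5, 8, 2), (6, 7, 3), (6, 8, 3), (6, 8, 0),
  (6, 8, 2), (7, 8, 3), (7, 8, 0), (7, 8, 2), (4, 7, 7), (4, 7, 8), (4, 8, 8), (5, 8, 8),
  (7, 8, 4), (7, 8, 5), (6, 7, 7), (6, 7, 8), (6, 8, 8), (7, 8, 6), (7, 8, 7), (7, 8, 8)]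

/-- The basis of the curvature module with coordinates `curvatureTerms`. -/
noncomputable def curvatureVector {g : Type*} [AddCommGroup g] [Module ℂ g] (x : Fin 9 → g)
    (i : Fin 24) : (g ⊗[ℂ] g) ⊗[ℂ] g :=
  ((curvatureTerms i).map fun t ↦
    (t.1 : ℂ) • wedgeTmul g (x t.2.1) (x t.2.2.1) (x t.2.2.2)).sum

section

variable {g : Type*} [AddCommGroup g] [Module ℂ g]

theorem wedgeTmul_apply (x y v : g) :
    wedgeTmul g x y v = (x ⊗ₜ[ℂ] y - y ⊗ₜ[ℂ] x) ⊗ₜ[ℂ] v := rfl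

theorem wedgeTmul_self (x v : g) : wedgeTmul g x x v = 0 := by
  simp [wedgeTmul_apply]

theorem wedgeTmul_neg_left (x y v : g) : wedgeTmul g (-x) y v = -wedgeTmul g x y v := by
  rw [← neg_one_smul ℂ x, ← neg_one_smul ℂ (wedgeTmul g x y v)]
  simp only [map_smul, LinearMap.smul_apply]

theorem LinearIndependent.exists_dual_family {x : Fin 9 → g} (hx : LinearIndependent ℂ x) :
    ∃ ξ : Fin 9 → Module.Dual ℂ g, ∀ i j, ξ i (x j) = if j = i then 1 else 0 := by
  obtain ⟨f, hf⟩ := LinearMap.exists_leftInverse_of_injective _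
    (LinearMap.ker_eq_bot.2 hx)
  refine ⟨fun i ↦ Finsupp.lapply i ∘ₗ f, fun i j ↦ ?_⟩
  have := LinearMap.congr_fun hf (Finsupp.single j 1)
  simp only [LinearMap.comp_apply, Finsupp.linearCombination_single, one_smul] at this
  simp [this, Finsupp.single_apply]

theorem linearIndependent_curvatureVector {x : Fin 9 → g} (hx : LinearIndependent ℂ x) :
    LinearIndependent ℂ (curvatureVector x) := by
  obtain ⟨ξ, hξ⟩ := hx.exists_dual_family
  let coord (p : Fin 9 × Fin 9 × Fin 9) : Module.Dual ℂ ((g ⊗[ℂ] g) ⊗[ℂ] g) :=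
    LinearMap.mul' ℂ ℂ ∘ₗ
      TensorProduct.map (LinearMap.mul' ℂ ℂ ∘ₗ TensorProduct.map (ξ p.1) (ξ p.2.1)) (ξ p.2.2)
  let Q : Matrix (Fin 24) (Fin 24) ℤ := fun i j ↦
    ((curvatureTerms j).map fun t ↦ t.1 * (((if t.2.1 = (curvaturePivot i).1 then 1 else 0) *
      (if t.2.2.1 = (curvaturePivot i).2.1 then 1 else 0) -
      (if t.2.2.1 = (curvaturePivot i).1 then 1 else 0) *
      (if t.2.1 = (curvaturePivot i).2.1 then 1 else 0)) *
      if t.2.2.2 = (curvaturePivot i).2.2 then 1 else 0)).sum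
  have hQ : ∀ i j, coord (curvaturePivot i) (curvatureVector x j) = Q i j := by
    intro i j
    simp only [curvatureVector, Q, map_list_sum, List.map_map, Int.cast_list_sum]
    congr 1
    refine List.map_congr_left fun t _ ↦ ?_
    simp only [coord, wedgeTmul_apply, TensorProduct.sub_tmul, hξ, Function.comp_apply, map_smul,
      map_sub, LinearMap.comp_apply, TensorProduct.map_tmul, LinearMap.mul'_apply, smul_eq_mul]
    push_cast
    ring
  have hupper : Q.BlockTriangular id := by
    have : ∀ i j, j < i → Q i j = 0 := by decide +kernel
    exact fun i j h ↦ this i j h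
  have hdiag : ∀ i, Q i i ≠ 0 := by decide +kernel
  have hdet : (Q.map (Int.cast : ℤ → ℂ)).det ≠ 0 := by
    rw [← Int.cast_det, Matrix.det_of_isUpperTriangular hupper]
    exact_mod_cast Finset.prod_ne_zero_iff.2 fun i _ ↦ hdiag i
  refine LinearIndependent.of_comp (LinearMap.pi fun i ↦ coord (curvaturePivot i)) ?_
  have hcol : (LinearMap.pi fun i ↦ coord (curvaturePivot i)) ∘ curvatureVector x =
      (Q.map (Int.cast : ℤ → ℂ)).col := funext₂ fun j i ↦ hQ i j
  rw [hcol]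
  exact Matrix.linearIndependent_cols_of_det_ne_zero hdet

end

section

variable {g : Type*} [LieRing g] [LieAlgebra ℂ g]

theorem lie_wedgeTmul (z x y v : g) :
    ⁅z, wedgeTmul g x y v⁆ =
      wedgeTmul g ⁅z, x⁆ y v + wedgeTmul g x ⁅z, y⁆ v + wedgeTmul g x y ⁅z, v⁆ := by
  simp only [wedgeTmul_apply, TensorProduct.LieModule.lie_tmul_right, lie_sub,
    TensorProduct.sub_tmul, TensorProduct.add_tmul]
  abel

theorem lie_curvatureVector (x : Fin 9 → g) (z : g) (i : Fin 24) :
    ⁅z, curvatureVector x i⁆ = ((curvatureTerms i).map fun t ↦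
      (t.1 : ℂ) • (wedgeTmul g ⁅z, x t.2.1⁆ (x t.2.2.1) (x t.2.2.2) +
        wedgeTmul g (x t.2.1) ⁅z, x t.2.2.1⁆ (x t.2.2.2) +
        wedgeTmul g (x t.2.1) (x t.2.2.1) ⁅z, x t.2.2.2⁆)).sum := by
  have h := map_list_sum (LieModule.toEnd ℂ g ((g ⊗[ℂ] g) ⊗[ℂ] g) z)
    ((curvatureTerms i).map fun t ↦
      (t.1 : ℂ) • wedgeTmul g (x t.2.1) (x t.2.2.1) (x t.2.2.2))
  rw [curvatureVector]
  simpa only [List.map_map, Function.comp_def, map_smul, LieModule.toEnd_apply_apply,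
    lie_wedgeTmul] using h

namespace IsParabolicFrame

variable {x : Fin 9 → g}

theorem lie_Z1_curvatureVector (hx : IsParabolicFrame x) (i : Fin 24) :
    ⁅x 0, curvatureVector x i⁆ = (![4, 4, 4, 4, 4, 5, 5, 5, 5, 6, 6, 6, 7, 7, 7, 7, 7, 7,
      8, 8, 8, 8, 9, 9] i : ℂ) • curvatureVector x i := by
  rw [lie_curvatureVector]
  fin_cases i <;> simp [curvatureVector, curvatureTerms, hx.lie_Z1] <;> module

theorem lie_Z2_curvatureVector (hx : IsParabolicFrame x) (i : Fin 24) :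
    ⁅x 1, curvatureVector x i⁆ = (![0, 1, 2, 3, 4, 1, 2, 3, 4, 2, 3, 4, 2, 3, 4, 5, 3, 4,
      3, 4, 5, 4, 4, 5] i : ℂ) • curvatureVector x i := by
  rw [lie_curvatureVector]
  fin_cases i <;> simp [curvatureVector, curvatureTerms, hx.lie_Z2] <;> module

theorem lie_e01_curvatureVector (hx : IsParabolicFrame x) (i : Fin 24) :
    ⁅x 2, curvatureVector x i⁆ = (![1, 2, 3, 4, 0, 1, 2, 3, 0, 1, 2, 0, 1, 2, 3, 0, 1, 0,
      1, 2, 0, 0, 1, 0] i : ℂ) • curvatureVector x (i + 1) := by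
  rw [lie_curvatureVector]
  fin_cases i <;> simp [curvatureVector, curvatureTerms, hx.lie_e01, wedgeTmul_self,
    wedgeTmul_neg_left] <;> module

theorem lie_f01_curvatureVector (hx : IsParabolicFrame x) (i : Fin 24) :
    ⁅x 3, curvatureVector x i⁆ = (![0, 4, 3, 2, 1, 0, 3, 2, 1, 0, 2, 1, 0, 3, 2, 1, 0, 1,
      0, 2, 1, 0, 0, 1] i : ℂ) • curvatureVector x (i - 1) := by
  rw [lie_curvatureVector]
  fin_cases i <;> simp [curvatureVector, curvatureTerms, hx.lie_f01, wedgeTmul_self,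
    wedgeTmul_neg_left] <;> module

theorem lie_e10_curvatureVector (hx : IsParabolicFrame x) (i : Fin 24) :
    ⁅x 4, curvatureVector x i⁆ =
      (![0, 1, 1, 1, 1, 0, -2, -2, -2, -3, -2, -1, 0, -2, -2, -2, 20, 10,
        0, -3, -3, 12, 0, 0] i : ℂ) •
        curvatureVector x (![0, 5, 6, 7, 8, 0, 9, 10, 11, 12, 13, 14, 0, 18, 19, 20, 18, 19,
          0, 22, 23, 22, 0, 0] i) +
      (![0, 0, 0, 0, 0, 0, 0, 0, 0, 0, 1, 1, 0, 0, 0, 0, 0, -12,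
        0, 0, 0, 0, 0, 0] i : ℂ) •
        curvatureVector x (![0, 0, 0, 0, 0, 0, 0, 0, 0, 0, 16, 17, 0, 0, 0, 0, 0, 21,
          0, 0, 0, 0, 0, 0] i) := by
  rw [lie_curvatureVector]
  fin_cases i <;> simp [curvatureVector, curvatureTerms, hx.lie_e10, wedgeTmul_self,
    wedgeTmul_neg_left] <;> module

theorem mem_of_mem_span (hx : IsParabolicFrame x) {K : LieSubalgebra ℂ g}
    (hK : ∀ i ≤ 4, x i ∈ K) {p : g} (hp : p ∈ Submodule.span ℂ (Set.range x)) : p ∈ K := by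
  have smul_mem {c : ℂ} (hc : c ≠ 0) {y : g} (hy : c • y ∈ K) : y ∈ K :=
    (K.toSubmodule.smul_mem_iff hc).1 hy
  have h2 : x 2 ∈ K := hK 2 (by decide)
  have h4 : x 4 ∈ K := hK 4 le_rfl
  have h5 : x 5 ∈ K := by simpa [hx.lie_e10] using K.lie_mem h4 h2
  have h6 : x 6 ∈ K := smul_mem two_ne_zero (by simpa [hx.lie_e10] using K.lie_mem h4 h5)
  have h7 : x 7 ∈ K := smul_mem (neg_ne_zero.2 three_ne_zero)
    ((hx.lie_e10 6).subst (motive := (· ∈ K)) (K.lie_mem h4 h6) : (-3 : ℂ) • x 7 ∈ K)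
  have h8 : x 8 ∈ K := by simpa [hx.lie_e01] using K.lie_mem h2 h7
  refine (Submodule.span_le (p := K.toSubmodule)).2 ?_ hp
  rintro _ ⟨i, rfl⟩
  by_cases hi : i ≤ 4
  · exact hK i hi
  · fin_cases i <;> first | assumption | exact absurd (by decide) hi

theorem lie_mem_span (hx : IsParabolicFrame x) {M : Type*} [AddCommGroup M] [Module ℂ M]
    [LieRingModule g M] [LieModule ℂ g M] {s : Set M}
    (hs : ∀ i ≤ 4, ∀ m ∈ s, ⁅x i, m⁆ ∈ Submodule.span ℂ s) {p : g}
    (hp : p ∈ Submodule.span ℂ (Set.range x)) {m : M} (hm : m ∈ Submodule.span ℂ s) :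
    ⁅p, m⁆ ∈ Submodule.span ℂ s := by
  refine hx.mem_of_mem_span (K := (Submodule.span ℂ s).lieStabilizer) (fun i hi m hm ↦ ?_) hp m hm
  exact (Submodule.span_le (p := (Submodule.span ℂ s).comap (LieModule.toEnd ℂ g M (x i)))).2
    (hs i hi) hm

theorem lie_mem_parabolic (hx : IsParabolicFrame x) {p q : g}
    (hp : p ∈ Submodule.span ℂ (Set.range x)) (hq : q ∈ Submodule.span ℂ (Set.range x)) :
    ⁅p, q⁆ ∈ Submodule.span ℂ (Set.range x) := by
  have hmem (i) : x i ∈ Submodule.span ℂ (Set.range x) := Submodule.subset_span ⟨i, rfl⟩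
  refine hx.lie_mem_span ?_ hp hq
  rintro i hi _ ⟨j, rfl⟩
  fin_cases i <;> first
    | exact absurd hi (by decide)
    | fin_cases j <;>
        simp [hx.lie_Z1, hx.lie_Z2, hx.lie_e01, hx.lie_f01, hx.lie_e10, hmem,
          Submodule.add_mem, Submodule.sub_mem]

theorem lie_mem_nilradical (hx : IsParabolicFrame x) {p y : g}
    (hp : p ∈ Submodule.span ℂ (Set.range x))
    (hy : y ∈ Submodule.span ℂ (x '' {4, 5, 6, 7, 8})) :
    ⁅p, y⁆ ∈ Submodule.span ℂ (x '' {4, 5, 6, 7, 8}) := by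
  have hmem (i) (hi : i ∈ ({4, 5, 6, 7, 8} : Set (Fin 9))) :
      x i ∈ Submodule.span ℂ (x '' {4, 5, 6, 7, 8}) := Submodule.subset_span ⟨i, hi, rfl⟩
  refine hx.lie_mem_span ?_ hp hy
  rintro i hi _ ⟨j, hj, rfl⟩
  fin_cases i <;> first
    | exact absurd hi (by decide)
    | rcases hj with rfl | rfl | rfl | rfl | rfl <;>
        simp [hx.lie_Z1, hx.lie_Z2, hx.lie_e01, hx.lie_f01, hx.lie_e10, hmem]

theorem lie_mem_span_curvatureVector (hx : IsParabolicFrame x) {p : g}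
    (hp : p ∈ Submodule.span ℂ (Set.range x)) {w : (g ⊗[ℂ] g) ⊗[ℂ] g}
    (hw : w ∈ Submodule.span ℂ (Set.range (curvatureVector x))) :
    ⁅p, w⁆ ∈ Submodule.span ℂ (Set.range (curvatureVector x)) := by
  have hmem (c : ℂ) (i) :
      c • curvatureVector x i ∈ Submodule.span ℂ (Set.range (curvatureVector x)) :=
    Submodule.smul_mem _ _ (Submodule.subset_span ⟨i, rfl⟩)
  refine hx.lie_mem_span ?_ hp hw
  rintro i hi _ ⟨j, rfl⟩
  fin_cases i
  · exact hx.lie_Z1_curvatureVector j ▸ hmem _ _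
  · exact hx.lie_Z2_curvatureVector j ▸ hmem _ _
  · exact hx.lie_e01_curvatureVector j ▸ hmem _ _
  · exact hx.lie_f01_curvatureVector j ▸ hmem _ _
  · exact hx.lie_e10_curvatureVector j ▸ Submodule.add_mem _ (hmem _ _) (hmem _ _)
  all_goals exact absurd hi (by decide)

theorem curvatureVector_mem (hx : IsParabolicFrame x) {E : Submodule ℂ ((g ⊗[ℂ] g) ⊗[ℂ] g)}
    (h0 : curvatureVector x 0 ∈ E) (h01 : ∀ w ∈ E, ⁅x 2, w⁆ ∈ E) (h10 : ∀ w ∈ E, ⁅x 4, w⁆ ∈ E)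
    (i : Fin 24) : curvatureVector x i ∈ E := by
  have smul_mem {c : ℂ} (hc : c ≠ 0) {w : (g ⊗[ℂ] g) ⊗[ℂ] g} (hw : c • w ∈ E) : w ∈ E :=
    (E.smul_mem_iff hc).1 hw
  have next (i : Fin 24) (hi : i ∉ ({4, 8, 11, 15, 17, 20, 21, 23} : Finset (Fin 24)))
      (h : curvatureVector x i ∈ E) : curvatureVector x (i + 1) ∈ E := by
    refine smul_mem ?_ (hx.lie_e01_curvatureVector i ▸ h01 _ h)
    fin_cases i <;> first | exact absurd (by decide) hi | simp
  have raise (i : Fin 24) (h : curvatureVector x i ∈ E) := hx.lie_e10_curvatureVector i ▸ h10 _ h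
  have h1 : curvatureVector x 1 ∈ E := next 0 (by decide) h0
  have h2 : curvatureVector x 2 ∈ E := next 1 (by decide) h1
  have h3 : curvatureVector x 3 ∈ E := next 2 (by decide) h2
  have h4 : curvatureVector x 4 ∈ E := next 3 (by decide) h3
  have h5 : curvatureVector x 5 ∈ E := by simpa using raise 1 h1
  have h6 : curvatureVector x 6 ∈ E := next 5 (by decide) h5
  have h7 : curvatureVector x 7 ∈ E := next 6 (by decide) h6
  have h8 : curvatureVector x 8 ∈ E := next 7 (by decide) h7
  have h9 : curvatureVector x 9 ∈ E := by simpa [E.smul_mem_iff] using raise 6 h6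
  have h10' : curvatureVector x 10 ∈ E := next 9 (by decide) h9
  have h11 : curvatureVector x 11 ∈ E := next 10 (by decide) h10'
  have h12 : curvatureVector x 12 ∈ E := by simpa [E.smul_mem_iff] using raise 9 h9
  have h13 : curvatureVector x 13 ∈ E := next 12 (by decide) h12
  have h14 : curvatureVector x 14 ∈ E := next 13 (by decide) h13
  have h15 : curvatureVector x 15 ∈ E := next 14 (by decide) h14
  have h16 : curvatureVector x 16 ∈ E := by
    simpa [E.add_mem_iff_right, E.neg_mem_iff, E.smul_mem, h13] using raise 10 h10'
  have h17 : curvatureVector x 17 ∈ E := next 16 (by decide) h16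
  have h18 : curvatureVector x 18 ∈ E := by simpa [E.smul_mem_iff] using raise 13 h13
  have h19 : curvatureVector x 19 ∈ E := next 18 (by decide) h18
  have h20 : curvatureVector x 20 ∈ E := next 19 (by decide) h19
  have h21 : curvatureVector x 21 ∈ E := by
    simpa [E.add_mem_iff_right, E.smul_mem_iff, h19] using raise 17 h17
  have h22 : curvatureVector x 22 ∈ E := by simpa [E.smul_mem_iff] using raise 19 h19
  have h23 : curvatureVector x 23 ∈ E := next 22 (by decide) h22
  fin_cases i <;> assumption

end IsParabolicFrame

theorem lie_mem_span_wedgeTmul {p : g} {A B : Submodule ℂ g} (hA : ∀ y ∈ A, ⁅p, y⁆ ∈ A)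
    (hB : ∀ v ∈ B, ⁅p, v⁆ ∈ B) {w : (g ⊗[ℂ] g) ⊗[ℂ] g}
    (hw : w ∈ Submodule.span ℂ {w | ∃ X ∈ A, ∃ Y ∈ A, ∃ v ∈ B, w = wedgeTmul g X Y v}) :
    ⁅p, w⁆ ∈ Submodule.span ℂ {w | ∃ X ∈ A, ∃ Y ∈ A, ∃ v ∈ B, w = wedgeTmul g X Y v} := by
  refine (Submodule.span_le (p := (Submodule.span ℂ _).comap
    (LieModule.toEnd ℂ g ((g ⊗[ℂ] g) ⊗[ℂ] g) p))).2 ?_ hw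
  rintro _ ⟨X, hX, Y, hY, v, hv, rfl⟩
  simp only [SetLike.mem_coe, Submodule.mem_comap, LieModule.toEnd_apply_apply, lie_wedgeTmul]
  exact add_mem (add_mem (Submodule.subset_span ⟨_, hA X hX, Y, hY, v, hv, rfl⟩)
    (Submodule.subset_span ⟨X, hX, _, hA Y hY, v, hv, rfl⟩))
    (Submodule.subset_span ⟨X, hX, Y, hY, _, hB v hv, rfl⟩)

/-- The Kostant codifferential is equivariant. -/
theorem codifferential_lie {δ : ((g ⊗[ℂ] g) ⊗[ℂ] g) →ₗ[ℂ] (g ⊗[ℂ] g)}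
    (hδ : ∀ X Y v : g, δ (wedgeTmul g X Y v) =
      -(Y ⊗ₜ[ℂ] ⁅X, v⁆) + X ⊗ₜ[ℂ] ⁅Y, v⁆ - ⁅X, Y⁆ ⊗ₜ[ℂ] v)
    (z : g) {A B : Submodule ℂ g} {w : (g ⊗[ℂ] g) ⊗[ℂ] g}
    (hw : w ∈ Submodule.span ℂ {w | ∃ X ∈ A, ∃ Y ∈ A, ∃ v ∈ B, w = wedgeTmul g X Y v}) :
    δ ⁅z, w⁆ = ⁅z, δ w⁆ := by
  refine (Submodule.span_le (p := LinearMap.eqLocus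
    (δ ∘ₗ LieModule.toEnd ℂ g ((g ⊗[ℂ] g) ⊗[ℂ] g) z)
    (LieModule.toEnd ℂ g (g ⊗[ℂ] g) z ∘ₗ δ))).2 ?_ hw
  rintro _ ⟨X, -, Y, -, v, -, rfl⟩
  simp only [SetLike.mem_coe, LinearMap.mem_eqLocus, LinearMap.comp_apply,
    LieModule.toEnd_apply_apply, lie_wedgeTmul, map_add, hδ, lie_add, lie_sub, lie_neg,
    TensorProduct.LieModule.lie_tmul_right, leibniz_lie z, TensorProduct.tmul_add,
    TensorProduct.add_tmul]
  abel

end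

theorem curvature_module_properties
    {g : Type*} [LieRing g] [LieAlgebra ℂ g]
    (Z1 Z2 e01 e10 e11 e21 e31 e32 f01 f10 f11 f21 f31 f32 : g)
    (hindep : LinearIndependent ℂ ![Z1, Z2, e01, e10, e11, e21, e31, e32, f01, f10, f11, f21, f31, f32])
    (hspan : Submodule.span ℂ (Set.range ![Z1, Z2, e01, e10, e11, e21, e31, e32, f01, f10, f11, f21, f31, f32]) = ⊤)
    (hZ1Z2 : ⁅Z1, Z2⁆ = 0)
    (hZ1e01 : ⁅Z1, e01⁆ = 0)
    (hZ1e10 : ⁅Z1, e10⁆ = e10)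
    (hZ1e11 : ⁅Z1, e11⁆ = e11)
    (hZ1e21 : ⁅Z1, e21⁆ = (2 : ℂ) • e21)
    (hZ1e31 : ⁅Z1, e31⁆ = (3 : ℂ) • e31)
    (hZ1e32 : ⁅Z1, e32⁆ = (3 : ℂ) • e32)
    (hZ1f01 : ⁅Z1, f01⁆ = 0)
    (hZ1f10 : ⁅Z1, f10⁆ = -f10)
    (hZ1f11 : ⁅Z1, f11⁆ = -f11)
    (hZ1f21 : ⁅Z1, f21⁆ = (-2 : ℂ) • f21)
    (hZ1f31 : ⁅Z1, f31⁆ = (-3 : ℂ) • f31)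
    (hZ1f32 : ⁅Z1, f32⁆ = (-3 : ℂ) • f32)
    (hZ2e01 : ⁅Z2, e01⁆ = e01)
    (hZ2e10 : ⁅Z2, e10⁆ = 0)
    (hZ2e11 : ⁅Z2, e11⁆ = e11)
    (hZ2e21 : ⁅Z2, e21⁆ = e21)
    (hZ2e31 : ⁅Z2, e31⁆ = e31)
    (hZ2e32 : ⁅Z2, e32⁆ = (2 : ℂ) • e32)
    (hZ2f01 : ⁅Z2, f01⁆ = -f01)
    (hZ2f10 : ⁅Z2, f10⁆ = 0)
    (hZ2f11 : ⁅Z2, f11⁆ = -f11)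
    (hZ2f21 : ⁅Z2, f21⁆ = -f21)
    (hZ2f31 : ⁅Z2, f31⁆ = -f31)
    (hZ2f32 : ⁅Z2, f32⁆ = (-2 : ℂ) • f32)
    (he01e10 : ⁅e01, e10⁆ = -e11)
    (he01e11 : ⁅e01, e11⁆ = 0)
    (he01e21 : ⁅e01, e21⁆ = 0)
    (he01e31 : ⁅e01, e31⁆ = e32)
    (he01e32 : ⁅e01, e32⁆ = 0)
    (he01f01 : ⁅e01, f01⁆ = -Z1 + (2 : ℂ) • Z2)
    (he01f10 : ⁅e01, f10⁆ = 0)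
    (he01f11 : ⁅e01, f11⁆ = f10)
    (he01f21 : ⁅e01, f21⁆ = 0)
    (he01f31 : ⁅e01, f31⁆ = 0)
    (he01f32 : ⁅e01, f32⁆ = -f31)
    (he10e11 : ⁅e10, e11⁆ = (2 : ℂ) • e21)
    (he10e21 : ⁅e10, e21⁆ = (-3 : ℂ) • e31)
    (he10e31 : ⁅e10, e31⁆ = 0)
    (he10e32 : ⁅e10, e32⁆ = 0)
    (he10f01 : ⁅e10, f01⁆ = 0)
    (he10f10 : ⁅e10, f10⁆ = (2 : ℂ) • Z1 + (-3 : ℂ) • Z2)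
    (he10f11 : ⁅e10, f11⁆ = (-3 : ℂ) • f01)
    (he10f21 : ⁅e10, f21⁆ = (-2 : ℂ) • f11)
    (he10f31 : ⁅e10, f31⁆ = f21)
    (he10f32 : ⁅e10, f32⁆ = 0)
    (he11e21 : ⁅e11, e21⁆ = (3 : ℂ) • e32)
    (he11e31 : ⁅e11, e31⁆ = 0)
    (he11e32 : ⁅e11, e32⁆ = 0)
    (he11f01 : ⁅e11, f01⁆ = e10)
    (he11f10 : ⁅e11, f10⁆ = (-3 : ℂ) • e01)
    (he11f11 : ⁅e11, f11⁆ = -Z1 + (3 : ℂ) • Z2)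
    (he11f21 : ⁅e11, f21⁆ = (2 : ℂ) • f10)
    (he11f31 : ⁅e11, f31⁆ = 0)
    (he11f32 : ⁅e11, f32⁆ = -f21)
    (he21e31 : ⁅e21, e31⁆ = 0)
    (he21e32 : ⁅e21, e32⁆ = 0)
    (he21f01 : ⁅e21, f01⁆ = 0)
    (he21f10 : ⁅e21, f10⁆ = (-2 : ℂ) • e11)
    (he21f11 : ⁅e21, f11⁆ = (2 : ℂ) • e10)
    (he21f21 : ⁅e21, f21⁆ = Z1)
    (he21f31 : ⁅e21, f31⁆ = -f10)
    (he21f32 : ⁅e21, f32⁆ = f11)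
    (he31e32 : ⁅e31, e32⁆ = 0)
    (he31f01 : ⁅e31, f01⁆ = 0)
    (he31f10 : ⁅e31, f10⁆ = e21)
    (he31f11 : ⁅e31, f11⁆ = 0)
    (he31f21 : ⁅e31, f21⁆ = -e10)
    (he31f31 : ⁅e31, f31⁆ = Z1 + -Z2)
    (he31f32 : ⁅e31, f32⁆ = f01)
    (he32f01 : ⁅e32, f01⁆ = -e31)
    (he32f10 : ⁅e32, f10⁆ = 0)
    (he32f11 : ⁅e32, f11⁆ = -e21)
    (he32f21 : ⁅e32, f21⁆ = e11)
    (he32f31 : ⁅e32, f31⁆ = e01)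
    (he32f32 : ⁅e32, f32⁆ = Z2)
    (hf01f10 : ⁅f01, f10⁆ = f11)
    (hf01f11 : ⁅f01, f11⁆ = 0)
    (hf01f21 : ⁅f01, f21⁆ = 0)
    (hf01f31 : ⁅f01, f31⁆ = -f32)
    (hf01f32 : ⁅f01, f32⁆ = 0)
    (hf10f11 : ⁅f10, f11⁆ = (-2 : ℂ) • f21)
    (hf10f21 : ⁅f10, f21⁆ = (3 : ℂ) • f31)
    (hf10f31 : ⁅f10, f31⁆ = 0)
    (hf10f32 : ⁅f10, f32⁆ = 0)
    (hf11f21 : ⁅f11, f21⁆ = (-3 : ℂ) • f32)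
    (hf11f31 : ⁅f11, f31⁆ = 0)
    (hf11f32 : ⁅f11, f32⁆ = 0)
    (hf21f31 : ⁅f21, f31⁆ = 0)
    (hf21f32 : ⁅f21, f32⁆ = 0)
    (hf31f32 : ⁅f31, f32⁆ = 0)
    (Pp : Submodule ℂ g)
    (hPp : Pp = Submodule.span ℂ ({e10, e11, e21, e31, e32} : Set g))
    (Pb : Submodule ℂ g)
    (hPb : Pb = Submodule.span ℂ
      ({Z1, Z2, e01, f01, e10, e11, e21, e31, e32} : Set g)) :
    (∀ x ∈ Pb, ∀ y ∈ Pp, ⁅x, y⁆ ∈ Pp) ∧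
    (∀ z x y v : g,
      ⁅z, (x ⊗ₜ[ℂ] y) ⊗ₜ[ℂ] v⁆ =
        (⁅z, x⁆ ⊗ₜ[ℂ] y) ⊗ₜ[ℂ] v + (x ⊗ₜ[ℂ] ⁅z, y⁆) ⊗ₜ[ℂ] v +
          (x ⊗ₜ[ℂ] y) ⊗ₜ[ℂ] ⁅z, v⁆) ∧
    (∀ E : Submodule ℂ ((g ⊗[ℂ] g) ⊗[ℂ] g),
      (e10 ⊗ₜ[ℂ] e31 - e31 ⊗ₜ[ℂ] e10) ⊗ₜ[ℂ] f01 ∈ E →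
      (∀ p ∈ Pb, ∀ w ∈ E, ⁅p, w⁆ ∈ E) →
      (∀ E' : Submodule ℂ ((g ⊗[ℂ] g) ⊗[ℂ] g),
        (e10 ⊗ₜ[ℂ] e31 - e31 ⊗ₜ[ℂ] e10) ⊗ₜ[ℂ] f01 ∈ E' →
        (∀ p ∈ Pb, ∀ w ∈ E', ⁅p, w⁆ ∈ E') → E ≤ E') →
      (Module.finrank ℂ E = 24 ∧
        E ≤ Submodule.span ℂ
          {w : (g ⊗[ℂ] g) ⊗[ℂ] g |
            ∃ X ∈ Pp, ∃ Y ∈ Pp, ∃ v ∈ Pb,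
              w = (X ⊗ₜ[ℂ] Y - Y ⊗ₜ[ℂ] X) ⊗ₜ[ℂ] v} ∧
        (∀ δ : ((g ⊗[ℂ] g) ⊗[ℂ] g) →ₗ[ℂ] (g ⊗[ℂ] g),
          (∀ X Y v : g,
            δ ((X ⊗ₜ[ℂ] Y - Y ⊗ₜ[ℂ] X) ⊗ₜ[ℂ] v) =
              -(Y ⊗ₜ[ℂ] ⁅X, v⁆) + X ⊗ₜ[ℂ] ⁅Y, v⁆ - ⁅X, Y⁆ ⊗ₜ[ℂ] v) →
          ∀ w ∈ E, δ w = 0))) := by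
  let x : Fin 9 → g := ![Z1, Z2, e01, f01, e10, e11, e21, e31, e32]
  have swap {y z w : g} (h : ⁅y, z⁆ = w) : ⁅z, y⁆ = -w := by rw [← lie_skew, h]
  have hx : IsParabolicFrame x := by
    constructor <;> intro j <;> fin_cases j <;>
      simp [x, *, swap hZ1Z2, swap hZ1e01, swap hZ2e01, swap hZ1f01, swap hZ2f01, swap he01f01,
        swap hZ1e10, swap hZ2e10, swap he01e10, swap he10f01, swap he11f01, swap he21f01,
        swap he31f01, swap he32f01, sub_eq_add_neg]
    exact add_comm _ _
  have hind : LinearIndependent ℂ x := by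
    convert hindep.comp ![0, 1, 2, 8, 3, 4, 5, 6, 7] (by decide) using 1
    ext j
    fin_cases j <;> rfl
  have hPb' : Pb = Submodule.span ℂ (Set.range x) := by
    rw [hPb]
    congr 1
    simp only [x, Matrix.range_cons, Matrix.range_empty, Set.union_empty, Set.singleton_union]
  have hPp' : Pp = Submodule.span ℂ (x '' {4, 5, 6, 7, 8}) := by
    rw [hPp]
    congr 1
    simp [x, Set.image_insert_eq]
  have hmemb (i) : x i ∈ Pb := hPb' ▸ Submodule.subset_span ⟨i, rfl⟩
  have hnil : ∀ p ∈ Pb, ∀ y ∈ Pp, ⁅p, y⁆ ∈ Pp := by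
    rw [hPb', hPp']
    exact fun p hp y hy ↦ hx.lie_mem_nilradical hp hy
  have hpar : ∀ p ∈ Pb, ∀ y ∈ Pb, ⁅p, y⁆ ∈ Pb := by
    rw [hPb']
    exact fun p hp y hy ↦ hx.lie_mem_parabolic hp hy
  have hφ : curvatureVector x 0 = (e10 ⊗ₜ[ℂ] e31 - e31 ⊗ₜ[ℂ] e10) ⊗ₜ[ℂ] f01 := by
    simp [curvatureVector, curvatureTerms, wedgeTmul_apply, x]
  refine ⟨hnil, fun z x y v ↦ ?_, fun E hφE hE hmin ↦ ?_⟩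
  · simp only [TensorProduct.LieModule.lie_tmul_right, TensorProduct.add_tmul]
  have hEspan : E = Submodule.span ℂ (Set.range (curvatureVector x)) := by
    refine le_antisymm (hmin _ (hφ ▸ Submodule.subset_span ⟨0, rfl⟩) fun p hp w hw ↦ ?_) ?_
    · exact hx.lie_mem_span_curvatureVector (hPb' ▸ hp) hw
    · rw [Submodule.span_le]
      rintro _ ⟨i, rfl⟩
      exact hx.curvatureVector_mem (hφ ▸ hφE) (hE _ (hmemb 2)) (hE _ (hmemb 4)) i
  let S : Submodule ℂ ((g ⊗[ℂ] g) ⊗[ℂ] g) :=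
    Submodule.span ℂ {w | ∃ X ∈ Pp, ∃ Y ∈ Pp, ∃ v ∈ Pb, w = wedgeTmul g X Y v}
  have hφS : (e10 ⊗ₜ[ℂ] e31 - e31 ⊗ₜ[ℂ] e10) ⊗ₜ[ℂ] f01 ∈ S :=
    Submodule.subset_span ⟨e10, hPp ▸ Submodule.subset_span (by simp),
      e31, hPp ▸ Submodule.subset_span (by simp), f01, hmemb 3, rfl⟩
  have hS : ∀ p ∈ Pb, ∀ w ∈ S, ⁅p, w⁆ ∈ S :=
    fun p hp w hw ↦ lie_mem_span_wedgeTmul (hnil p hp) (hpar p hp) hw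
  refine ⟨?_, hmin S hφS hS, fun δ hδ w hw ↦ ?_⟩
  · rw [hEspan, finrank_span_eq_card (linearIndependent_curvatureVector hind), Fintype.card_fin]
  · refine (hmin (S ⊓ LinearMap.ker δ) ⟨hφS, ?_⟩ (fun p hp w hw ↦ ⟨hS p hp w hw.1, ?_⟩) hw).2
    · simp [hδ, he10f01, he31f01, he10e31]
    · exact (codifferential_lie hδ p hw.1).trans ((congrArg _ hw.2).trans (lie_zero p))
end
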